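/- Let f : ℝ^d → ℝ be bounded and measurable with all second order partial derivatives ∂²f/∂x_k∂x_l (1 ≤ k,l ≤ d) bounded and Hölder continuous with exponent α ∈ (0,1]. Define E(s,x) := ∫_{ℝ^d} f(y) K^{BS}(s;x,y) dy, u(t,x) := 2ⁿ ∫_{(0,∞)ⁿ} E(s,x) ∏_{i=1}ⁿ K^{BM}(t_i;0,s_i) ds, and for each j ∈ {1,…,n}, 𝒰^{(j)}(t,x) := 2ⁿ ∫_{(0,∞)ⁿ} (∏_{i∈{1,…,n}\{j}} s_i)² E(s,x) ∏_{i=1}ⁿ K^{BM}(t_i;0,s_i) ds, for t ∈ (0,∞)ⁿ and x ∈ ℝ^d. Then: (a) for every j ∈ {1,…,n}, t ∈ (0,∞)ⁿ and x ∈ ℝ^d, ∂u/∂t_j (t,x) = √( (∏_{i∈{1,…,n}\{j}} t_i) / (2^{4−n} πⁿ t_j) ) Δ_x f(x) + (1/8) Δ_x² 𝒰^{(j)}(t,x); (b) for every t₀ ∈ [0,∞)ⁿ with at least one zero coordinate, u(t,x) → f(x) as t → t₀ within (0,∞)ⁿ; (c) for each j, 𝒰^{(j)}(t,x) → 0 as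 t → t₀ within (0,∞)ⁿ whenever t₀ has a zero coordinate in a position other than j; and (d) for each j and fixed (t_i)_{i≠j} ∈ (0,∞)^{n−1}, 𝒰^{(j)}(t,x) → (∏_{i∈{1,…,n}\{j}} t_i) f(x) as t_j → 0⁺. -/

import Mathlib

open MeasureTheory Real Filter Finset

noncomputable section

/-- Partial derivative of `g` in the `k`-th coordinate direction, at `x`. -/
def pd {m : ℕ} {E : Type*} [NormedAddCommGroup E] [NormedSpace ℝ E]
    (k : Fin m) (g : (Fin m → ℝ) → E) (x : Fin m → ℝ) : E :=
  deriv (fun h : ℝ => g (Function.update x k h)) (x k)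

/-- The Laplacian of `g : ℝ^m → E`, as the sum of its second coordinate partials. -/
def lap {m : ℕ} {E : Type*} [NormedAddCommGroup E] [NormedSpace ℝ E]
    (g : (Fin m → ℝ) → E) (x : Fin m → ℝ) : E :=
  ∑ k, pd k (pd k g) x

/-- The `n`-parameter `d`-dimensional Brownian sheet kernel
`K^{BS}(t;x,y) = (2π t₁⋯t_n)^{-d/2} exp(-|x-y|²/(2 t₁⋯t_n))`. -/
def Kbs (n d : ℕ) (t : Fin n → ℝ) (x y : Fin d → ℝ) : ℝ :=
  (2 * π * ∏ i, t i) ^ (-(d : ℝ) / 2) *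
    Real.exp (-(∑ k, (x k - y k) ^ 2) / (2 * ∏ i, t i))

/-- The one-dimensional heat (Brownian motion transition) kernel
`K^{BM}(t;0,s) = (2πt)^{-1/2} exp(-s²/(2t))`. -/
def Kbm (t s : ℝ) : ℝ :=
  (2 * π * t) ^ (-(1 : ℝ) / 2) * Real.exp (-(s ^ 2) / (2 * t))

/-- The `n`-parameter `d`-dimensional complex propagator kernel
`p_{is}(x,y) = (2πi s₁⋯s_n)^{-d/2} exp(-|x-y|²/(2i s₁⋯s_n))` (principal branch). -/
def pProp (n d : ℕ) (s : Fin n → ℝ) (x y : Fin d → ℝ) : ℂ :=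
  (2 * (π : ℂ) * Complex.I * ∏ i, (s i : ℂ)) ^ (-(d : ℂ) / 2) *
    Complex.exp (-((∑ k, (x k - y k) ^ 2 : ℝ) : ℂ) /
      (2 * Complex.I * ∏ i, (s i : ℂ)))


theorem integrable_and_hasDerivAt_integral_mul_exp {Ω : Type*} [MeasurableSpace Ω] {μ : Measure Ω}
    {G X : Ω → ℝ} (hX : AEStronglyMeasurable X μ) {S : Set ℝ} {a₀ : ℝ} (hS : S ∈ nhds a₀)
    (hint : ∀ a ∈ S, Integrable (fun ω => G ω * exp (a * X ω)) μ) :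
    Integrable (fun ω => G ω * (X ω * exp (a₀ * X ω))) μ ∧
      HasDerivAt (fun a => ∫ ω, G ω * exp (a * X ω) ∂μ)
        (∫ ω, G ω * (X ω * exp (a₀ * X ω)) ∂μ) a₀ := by
  obtain ⟨ε, hε, hball⟩ := Metric.mem_nhds_iff.1 hS
  set δ := ε / 3 with hδ
  have hδ0 : 0 < δ := by positivity
  have hmem : ∀ a, |a - a₀| ≤ 2 * δ → a ∈ S := fun a ha =>
    hball (by rw [Metric.mem_ball, Real.dist_eq]; linarith)
  have key : ∀ a ∈ Metric.ball a₀ δ, ∀ X : ℝ,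
      |X| * exp (a * X) ≤ δ⁻¹ * (exp ((a₀ + 2 * δ) * X) + exp ((a₀ - 2 * δ) * X)) := by
    intro a ha X
    rw [Metric.mem_ball, Real.dist_eq, abs_lt] at ha
    have h1 : |X| ≤ δ⁻¹ * exp (δ * |X|) := by
      rw [← div_eq_inv_mul, le_div_iff₀ hδ0]
      linarith [add_one_le_exp (δ * |X|)]
    have h2 : |X| * exp (a * X) ≤ δ⁻¹ * exp (δ * |X| + a * X) := by
      rw [exp_add, ← mul_assoc]
      exact mul_le_mul_of_nonneg_right h1 (exp_pos _).le
    refine h2.trans (mul_le_mul_of_nonneg_left ?_ (by positivity))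
    rcases le_total 0 X with h | h
    · rw [abs_of_nonneg h]
      have : exp (δ * X + a * X) ≤ exp ((a₀ + 2 * δ) * X) := exp_le_exp.2 (by nlinarith)
      linarith [exp_pos ((a₀ - 2 * δ) * X)]
    · rw [abs_of_nonpos h]
      have : exp (δ * -X + a * X) ≤ exp ((a₀ - 2 * δ) * X) := exp_le_exp.2 (by nlinarith)
      linarith [exp_pos ((a₀ + 2 * δ) * X)]
  have h0 := hint a₀ (hmem a₀ (by simpa using hδ0.le))
  have hp := hint (a₀ + 2 * δ) (hmem _ (by simp [abs_of_pos hδ0]))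
  have hm := hint (a₀ - 2 * δ) (hmem _ (by simp [abs_of_pos hδ0]))
  refine hasDerivAt_integral_of_dominated_loc_of_deriv_le
    (F' := fun a ω => G ω * (X ω * exp (a * X ω)))
    (bound := fun ω => δ⁻¹ * (‖G ω * exp ((a₀ + 2 * δ) * X ω)‖ + ‖G ω * exp ((a₀ - 2 * δ) * X ω)‖))
    (Metric.ball_mem_nhds a₀ hδ0) ?_ h0 ?_ ?_ ?_ ?_
  · filter_upwards [hS] with a ha using (hint a ha).aestronglyMeasurable
  · have := h0.aestronglyMeasurable.mul hX
    refine this.congr (ae_of_all _ fun ω => ?_)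
    simp only [Pi.mul_apply]; ring
  · refine ae_of_all _ fun ω a ha => ?_
    simp only [norm_mul, Real.norm_eq_abs, abs_exp]
    calc |G ω| * (|X ω| * exp (a * X ω))
        ≤ |G ω| * (δ⁻¹ * (exp ((a₀ + 2 * δ) * X ω) + exp ((a₀ - 2 * δ) * X ω))) :=
          mul_le_mul_of_nonneg_left (key a ha _) (abs_nonneg _)
      _ = _ := by ring
  · exact (hp.norm.add hm.norm).const_mul _
  · refine ae_of_all _ fun ω a _ => ?_
    have := (((hasDerivAt_id a).mul_const (X ω)).exp).const_mul (G ω)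
    simp only [id, one_mul] at this
    exact this.congr_deriv (by ring)

/-- The heat kernel on `ℝ^d` at time `τ`. -/
def heatKernel {d : ℕ} (τ : ℝ) (x y : Fin d → ℝ) : ℝ :=
  (2 * π * τ) ^ (-(d : ℝ) / 2) * exp (-(∑ k, (x k - y k) ^ 2) / (2 * τ))

/-- The heat semigroup on `ℝ^d` at time `τ`. -/
def heat {d : ℕ} (τ : ℝ) (G : (Fin d → ℝ) → ℝ) (x : Fin d → ℝ) : ℝ :=
  ∫ y, G y * heatKernel τ x y

/-- `G'` is the partial derivative of `G` in the `k`-th coordinate direction at `x`. -/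
def HasPd {m : ℕ} (k : Fin m) (G : (Fin m → ℝ) → ℝ) (G' : ℝ) (x : Fin m → ℝ) : Prop :=
  HasDerivAt (fun h => G (Function.update x k h)) G' (x k)

theorem HasPd.pd {m : ℕ} {k : Fin m} {G : (Fin m → ℝ) → ℝ} {G' : ℝ} {x : Fin m → ℝ}
    (h : HasPd k G G' x) : pd k G x = G' := h.deriv

theorem HasPd.hasDerivAt_update {m : ℕ} {k : Fin m} {G : (Fin m → ℝ) → ℝ}
    {G' : ℝ} {x : Fin m → ℝ} {h : ℝ} (hG : HasPd k G G' (Function.update x k h)) :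
    HasDerivAt (fun h => G (Function.update x k h)) G' h := by
  simpa [HasPd] using hG

theorem sum_update_sub_sq {d : ℕ} (k : Fin d) (x y : Fin d → ℝ) (h : ℝ) :
    ∑ i, (Function.update x k h i - y i) ^ 2 =
      (∑ i ∈ univ.erase k, (x i - y i) ^ 2) + (h - y k) ^ 2 := by
  rw [← Finset.sum_erase_add _ _ (mem_univ k), Function.update_self]
  congr 1
  refine Finset.sum_congr rfl fun i hi => ?_
  rw [Function.update_of_ne (Finset.ne_of_mem_erase hi)]

theorem heatKernel_update {d : ℕ} (k : Fin d) {τ : ℝ} (hτ : 0 < τ) (x y : Fin d → ℝ) (h : ℝ) :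
    heatKernel τ (Function.update x k h) y =
      exp (-h ^ 2 / (2 * τ)) * (heatKernel τ (Function.update x k 0) y * exp (h * (y k / τ))) := by
  unfold heatKernel
  rw [sum_update_sub_sq, sum_update_sub_sq, mul_left_comm, mul_assoc (_ ^ _) (exp _), ← exp_add,
    ← exp_add]
  congr 2
  field_simp
  ring

/-- The Gaussian-weighted partial derivative, for `G` of arbitrary (integrable) growth. -/
theorem heat_hasPd {d : ℕ} (k : Fin d) {τ : ℝ} (hτ : 0 < τ) {G : (Fin d → ℝ) → ℝ}
    (hG : ∀ x, Integrable (fun y => G y * heatKernel τ x y)) (x : Fin d → ℝ) :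
    Integrable (fun y => (y k * G y) * heatKernel τ x y) ∧
    HasPd k (heat τ G) ((heat τ (fun y => y k * G y) x - x k * heat τ G x) / τ) x := by
  have e1 : ∀ h y, G y * heatKernel τ (Function.update x k h) y = exp (-h ^ 2 / (2 * τ)) *
      (G y * heatKernel τ (Function.update x k 0) y * exp (h * (y k / τ))) := by
    intro h y; rw [heatKernel_update k hτ]; ring
  have hint : ∀ a ∈ (Set.univ : Set ℝ), Integrable (fun y : Fin d → ℝ =>
      G y * heatKernel τ (Function.update x k 0) y * exp (a * (y k / τ))) := by
    intro a _
    have := (hG (Function.update x k a)).const_mul (exp (-a ^ 2 / (2 * τ)))⁻¹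
    refine this.congr (ae_of_all _ fun y => ?_)
    simp only [e1 a y]
    rw [inv_mul_cancel_left₀ (exp_pos _).ne']
  obtain ⟨hi, hd⟩ := integrable_and_hasDerivAt_integral_mul_exp
    (G := fun y : Fin d → ℝ => G y * heatKernel τ (Function.update x k 0) y)
    (X := fun y => y k / τ)
    (Continuous.aestronglyMeasurable (by fun_prop)) (Filter.univ_mem (f := nhds (x k))) hint
  have e2 : ∀ y : Fin d → ℝ, (y k * G y) * heatKernel τ x y = τ * exp (-(x k) ^ 2 / (2 * τ)) *
      (G y * heatKernel τ (Function.update x k 0) y * (y k / τ * exp (x k * (y k / τ)))) := by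
    intro y
    have := e1 (x k) y
    rw [Function.update_eq_self] at this
    rw [mul_assoc, this]
    field_simp
  constructor
  · simp_rw [e2]
    exact hi.const_mul _
  · unfold HasPd heat
    have e3 : ∀ h, ∫ y, G y * heatKernel τ (Function.update x k h) y = exp (-h ^ 2 / (2 * τ)) *
        ∫ y, G y * heatKernel τ (Function.update x k 0) y * exp (h * (y k / τ)) := fun h => by
      rw [← integral_const_mul]
      exact integral_congr_ae (ae_of_all _ (e1 h))
    have e4 := e3 (x k)
    rw [Function.update_eq_self] at e4
    rw [funext e3, e4]
    simp_rw [e2, integral_const_mul]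
    have h3 : HasDerivAt (fun h : ℝ => exp (-h ^ 2 / (2 * τ)))
        (exp (-(x k) ^ 2 / (2 * τ)) * (-(x k) / τ)) (x k) := by
      have := (((hasDerivAt_pow 2 (x k)).neg).div_const (2 * τ)).exp
      refine this.congr_deriv ?_
      simp only [Pi.neg_apply]
      field_simp
      simp [mul_comm]
    refine (h3.mul hd).congr_deriv ?_
    field_simp
    ring

theorem heat_hasPd_hasPd {d : ℕ} (k : Fin d) {τ : ℝ} (hτ : 0 < τ) {G : (Fin d → ℝ) → ℝ}
    (hG : ∀ x, Integrable (fun y => G y * heatKernel τ x y)) (x : Fin d → ℝ) :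
    Integrable (fun y => G y * ((y k - x k) ^ 2 * heatKernel τ x y)) ∧
    HasPd k (fun x => (heat τ (fun y => y k * G y) x - x k * heat τ G x) / τ)
      ((∫ y, G y * ((y k - x k) ^ 2 * heatKernel τ x y)) / τ ^ 2 - heat τ G x / τ) x := by
  have h1 := heat_hasPd k hτ hG
  have h2 := heat_hasPd k hτ fun x => (h1 x).1
  have e : ∀ y, G y * ((y k - x k) ^ 2 * heatKernel τ x y) =
      ((y k * (y k * G y)) * heatKernel τ x y - 2 * x k * (y k * G y * heatKernel τ x y))
        + (x k) ^ 2 * (G y * heatKernel τ x y) := by intro y; ring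
  have i12 := (h2 x).1.sub ((h1 x).1.const_mul (2 * x k))
  have i3 := (hG x).const_mul ((x k) ^ 2)
  refine ⟨?_, ?_⟩
  · simp_rw [e]
    exact i12.add i3
  · have e' : ∫ y, G y * ((y k - x k) ^ 2 * heatKernel τ x y) =
        heat τ (fun y => y k * (y k * G y)) x - 2 * x k * heat τ (fun y => y k * G y) x
          + (x k) ^ 2 * heat τ G x := by
      simp_rw [e]
      rw [integral_add (f := fun y => _ - _) i12 i3,
        integral_sub (h2 x).1 ((h1 x).1.const_mul (2 * x k)),
        integral_const_mul, integral_const_mul]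
      rfl
    have hd := (HasDerivAt.sub (h2 x).2 ((hasDerivAt_id (x k)).mul (h1 x).2)).div_const τ
    unfold HasPd
    simp only [Function.update_self]
    refine hd.congr_deriv ?_
    rw [e']
    simp only [id, Function.update_eq_self]
    field_simp
    ring

theorem heat_hasDerivAt_time {d : ℕ} {τ : ℝ} (hτ : 0 < τ) {G : (Fin d → ℝ) → ℝ}
    (hG : ∀ τ, 0 < τ → ∀ x, Integrable (fun y => G y * heatKernel τ x y)) (x : Fin d → ℝ) :
    HasDerivAt (fun τ => heat τ G x) ((1 / 2) * ∑ k,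
      ((∫ y, G y * ((y k - x k) ^ 2 * heatKernel τ x y)) / τ ^ 2 - heat τ G x / τ)) τ := by
  have e1 : ∀ σ, 0 < σ → ∀ y, G y * heatKernel σ x y = (2 * π * σ) ^ (-(d : ℝ) / 2) *
      (G y * exp ((1 / (2 * σ)) * -(∑ k, (x k - y k) ^ 2))) := by
    intro σ _ y
    unfold heatKernel
    rw [mul_left_comm]
    congr 4
    ring
  have hint : ∀ a ∈ Set.Ioi (0 : ℝ), Integrable (fun y : Fin d → ℝ =>
      G y * exp (a * -(∑ k, (x k - y k) ^ 2))) := by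
    intro a ha
    have ha : 0 < a := ha
    have h2a : 0 < 1 / (2 * a) := by positivity
    have := (hG _ h2a x).const_mul ((2 * π * (1 / (2 * a))) ^ (-(d : ℝ) / 2))⁻¹
    refine this.congr (ae_of_all _ fun y => ?_)
    simp only [e1 _ h2a y]
    rw [inv_mul_cancel_left₀ (by positivity)]
    congr 4
    field_simp
  have hpos : 0 < 1 / (2 * τ) := by positivity
  obtain ⟨_, hd⟩ := integrable_and_hasDerivAt_integral_mul_exp
    (G := G) (X := fun y => -(∑ k, (x k - y k) ^ 2))
    (Continuous.aestronglyMeasurable (by fun_prop)) (Ioi_mem_nhds hpos) hint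
  have hinv : HasDerivAt (fun σ : ℝ => 1 / (2 * σ)) (-1 / (2 * τ ^ 2)) τ := by
    have := (hasDerivAt_inv hτ.ne').const_mul (1 / 2)
    refine (this.congr_deriv (by field_simp)).congr_of_eventuallyEq ?_
    exact Eventually.of_forall fun σ => by simp [mul_comm]
  have hpow : HasDerivAt (fun σ : ℝ => (2 * π * σ) ^ (-(d : ℝ) / 2))
      ((2 * π * τ) ^ (-(d : ℝ) / 2) * (-(d : ℝ) / (2 * τ))) τ := by
    have := ((hasDerivAt_id τ).const_mul (2 * π)).rpow_const (p := -(d : ℝ) / 2)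
      (Or.inl (by simp only [id]; positivity))
    refine this.congr_deriv ?_
    rw [rpow_sub_one (by simp only [id]; positivity)]
    simp only [id]
    field_simp
  have hcomp := hpow.mul (hd.comp τ hinv)
  refine (hcomp.congr_deriv ?_).congr_of_eventuallyEq ?_
  · have e3 : heat τ G x = (2 * π * τ) ^ (-(d : ℝ) / 2) *
        ∫ y, G y * exp ((1 / (2 * τ)) * -(∑ k, (x k - y k) ^ 2)) := by
      unfold heat
      simp_rw [e1 τ hτ, integral_const_mul]
    have e4 : ∑ k, ∫ y, G y * ((y k - x k) ^ 2 * heatKernel τ x y) =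
        -(2 * π * τ) ^ (-(d : ℝ) / 2) * ∫ y, G y * (-(∑ k, (x k - y k) ^ 2) *
          exp ((1 / (2 * τ)) * -(∑ k, (x k - y k) ^ 2))) := by
      rw [← integral_finsetSum _ fun k _ => (heat_hasPd_hasPd k hτ (hG τ hτ) x).1,
        ← integral_const_mul]
      refine integral_congr_ae (ae_of_all _ fun y => ?_)
      have := e1 τ hτ y
      simp only
      calc ∑ k, G y * ((y k - x k) ^ 2 * heatKernel τ x y)
          = (∑ k, (x k - y k) ^ 2) * (G y * heatKernel τ x y) := by
            rw [Finset.sum_mul]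
            exact Finset.sum_congr rfl fun k _ => by ring
        _ = _ := by rw [this]; ring
    rw [Finset.sum_sub_distrib, ← Finset.sum_div, e4, e3]
    simp only [Finset.sum_const, card_univ, Fintype.card_fin, nsmul_eq_mul, Function.comp]
    field_simp
    ring
  · filter_upwards [Ioi_mem_nhds hτ] with σ hσ
    unfold heat
    simp_rw [e1 σ hσ, integral_const_mul]
    rfl


theorem integrable_exp_neg_mul_sum_sq {d : ℕ} {b : ℝ} (hb : 0 < b) (x : Fin d → ℝ) :
    Integrable (fun y : Fin d → ℝ => exp (-b * ∑ k, (x k - y k) ^ 2)) := by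
  have := Integrable.fintype_prod (μ := fun _ : Fin d => (volume : Measure ℝ))
    (f := fun k y => exp (-b * (x k - y) ^ 2))
    (fun k => (integrable_exp_neg_mul_sq hb).comp_sub_left (x k))
  refine this.congr (ae_of_all _ fun y => ?_)
  simp only [← exp_sum, Finset.mul_sum]

theorem heatKernel_pos {d : ℕ} {τ : ℝ} (hτ : 0 < τ) (x y : Fin d → ℝ) : 0 < heatKernel τ x y := by
  unfold heatKernel; positivity

theorem continuous_heatKernel {d : ℕ} (τ : ℝ) (x : Fin d → ℝ) : Continuous (heatKernel τ x) := by
  unfold heatKernel; fun_prop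

theorem integrable_heatKernel {d : ℕ} {τ : ℝ} (hτ : 0 < τ) (x : Fin d → ℝ) :
    Integrable (heatKernel τ x) := by
  have := (integrable_exp_neg_mul_sum_sq (b := 1 / (2 * τ)) (by positivity) x).const_mul
    ((2 * π * τ) ^ (-(d : ℝ) / 2))
  refine this.congr (ae_of_all _ fun y => ?_)
  simp only [heatKernel]
  congr 2
  ring

theorem integrable_mul_heatKernel {d : ℕ} {τ : ℝ} (hτ : 0 < τ) {G : (Fin d → ℝ) → ℝ}
    (hG : Measurable G) {B : ℝ} (hB : ∀ y, |G y| ≤ B) (x : Fin d → ℝ) :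
    Integrable (fun y => G y * heatKernel τ x y) :=
  (integrable_heatKernel hτ x).bdd_mul hG.aestronglyMeasurable (ae_of_all _ hB)

theorem integral_heatKernel_one {d : ℕ} : ∫ z : Fin d → ℝ, heatKernel 1 0 z = 1 := by
  have e : ∀ z : Fin d → ℝ, heatKernel 1 0 z =
      (2 * π) ^ (-(d : ℝ) / 2) * ∏ k, exp (-(1 / 2) * (z k) ^ 2) := by
    intro z
    rw [heatKernel, ← exp_sum, ← Finset.mul_sum]
    simp only [mul_one, Pi.zero_apply, zero_sub, neg_sq]
    congr 2
    ring
  simp_rw [e, integral_const_mul]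
  rw [volume_pi, integral_fintype_prod_eq_prod (fun (_ : Fin d) (y : ℝ) => exp (-(1 / 2) * y ^ 2)),
    integral_gaussian, Finset.prod_const, card_univ, Fintype.card_fin]
  have : π / (1 / 2) = 2 * π := by ring
  rw [this, sqrt_eq_rpow, ← rpow_natCast, ← rpow_mul (by positivity), ← rpow_add (by positivity)]
  rw [show -(d : ℝ) / 2 + 1 / 2 * d = 0 by ring, rpow_zero]

theorem heatKernel_one_eq {d : ℕ} {τ : ℝ} (hτ : 0 < τ) (x z : Fin d → ℝ) :
    heatKernel 1 0 z = √τ ^ d * heatKernel τ x (x + √τ • z) := by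
  unfold heatKernel
  have h1 : (2 * π * τ) ^ (-(d : ℝ) / 2) = (√τ ^ d)⁻¹ * (2 * π) ^ (-(d : ℝ) / 2) := by
    rw [mul_rpow (by positivity) hτ.le, mul_comm, sqrt_eq_rpow, ← rpow_natCast,
      ← rpow_mul hτ.le, ← rpow_neg hτ.le]
    congr 2
    ring
  have h2 : ∑ k, (x k - (x + √τ • z) k) ^ 2 = τ * ∑ k, z k ^ 2 := by
    rw [Finset.mul_sum]
    refine Finset.sum_congr rfl fun k _ => ?_
    simp only [Pi.add_apply, Pi.smul_apply, smul_eq_mul]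
    rw [show x k - (x k + √τ * z k) = -(√τ * z k) by ring, neg_sq, mul_pow, sq_sqrt hτ.le]
  rw [h1, h2]
  have h3 : √τ ^ d ≠ 0 := by positivity
  rw [← mul_assoc, ← mul_assoc, mul_inv_cancel₀ h3]
  simp only [mul_one, Pi.zero_apply, zero_sub, neg_sq, one_mul]
  congr 2
  field_simp

theorem integral_mul_heatKernel {d : ℕ} {τ : ℝ} (hτ : 0 < τ) (F : (Fin d → ℝ) → ℝ)
    (x : Fin d → ℝ) :
    ∫ y, F y * heatKernel τ x y = ∫ z, F (x + √τ • z) * heatKernel 1 0 z := by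
  have h0 : 0 < √τ := sqrt_pos.2 hτ
  simp_rw [heatKernel_one_eq hτ x]
  rw [Measure.integral_comp_smul volume
    (fun w => F (x + w) * (√τ ^ d * heatKernel τ x (x + w))) (√τ)]
  rw [integral_add_left_eq_self (fun w => F w * (√τ ^ d * heatKernel τ x w)) x]
  simp_rw [mul_left_comm _ (√τ ^ d)]
  rw [integral_const_mul, Module.finrank_fin_fun, abs_of_pos (by positivity), smul_eq_mul,
    inv_mul_cancel_left₀ (by positivity)]

theorem heat_eq {d : ℕ} {τ : ℝ} (hτ : 0 < τ) (G : (Fin d → ℝ) → ℝ) (x : Fin d → ℝ) :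
    heat τ G x = ∫ z, G (x + √τ • z) * heatKernel 1 0 z :=
  integral_mul_heatKernel hτ G x

theorem integrable_sq_mul_heatKernel {d : ℕ} :
    Integrable (fun z : Fin d → ℝ => (1 + ∑ k, z k ^ 2) ^ 2 * heatKernel 1 0 z) := by
  have := (integrable_exp_neg_mul_sum_sq (d := d) (b := 1 / 4) (by norm_num) 0).const_mul
    (64 * (2 * π) ^ (-(d : ℝ) / 2))
  refine this.mono' (Continuous.aestronglyMeasurable
    (by have := continuous_heatKernel (d := d) 1 0; fun_prop)) (ae_of_all _ fun z => ?_)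
  have h0 : 0 ≤ ∑ k, z k ^ 2 := Finset.sum_nonneg fun k _ => sq_nonneg _
  rw [norm_mul, Real.norm_of_nonneg (by positivity),
    Real.norm_of_nonneg (heatKernel_pos one_pos _ _).le]
  unfold heatKernel
  simp only [mul_one, Pi.zero_apply, zero_sub, neg_sq]
  set S := ∑ k, z k ^ 2
  have h1 : 1 + S ≤ 8 * exp (S / 8) := by linarith [add_one_le_exp (S / 8)]
  have h2 : (1 + S) ^ 2 ≤ 64 * exp (S / 4) := by
    calc (1 + S) ^ 2 ≤ (8 * exp (S / 8)) ^ 2 := by gcongr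
      _ = 64 * exp (S / 4) := by rw [mul_pow, ← exp_nat_mul]; norm_num; ring
  calc (1 + S) ^ 2 * ((2 * π) ^ (-(d : ℝ) / 2) * exp (-S / 2))
      ≤ 64 * exp (S / 4) * ((2 * π) ^ (-(d : ℝ) / 2) * exp (-S / 2)) := by gcongr
    _ = 64 * (2 * π) ^ (-(d : ℝ) / 2) * (exp (S / 4) * exp (-S / 2)) := by ring
    _ = 64 * (2 * π) ^ (-(d : ℝ) / 2) * exp (-(1 / 4) * S) := by
      rw [← exp_add]; congr 2; ring

theorem integrable_poly_mul_heatKernel {d : ℕ} {P : (Fin d → ℝ) → ℝ} (hP : Measurable P) {C : ℝ}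
    (hC : ∀ z, |P z| ≤ C * (1 + ∑ k, z k ^ 2) ^ 2) :
    Integrable (fun z : Fin d → ℝ => P z * heatKernel 1 0 z) := by
  refine (integrable_sq_mul_heatKernel.const_mul C).mono'
    (hP.mul (continuous_heatKernel 1 0).measurable).aestronglyMeasurable (ae_of_all _ fun z => ?_)
  rw [norm_mul, Real.norm_of_nonneg (heatKernel_pos one_pos _ _).le, ← mul_assoc]
  exact mul_le_mul_of_nonneg_right (hC z) (heatKernel_pos one_pos _ _).le

theorem measurable_heat {d : ℕ} {G : (Fin d → ℝ) → ℝ} (hG : Measurable G) (x : Fin d → ℝ) :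
    Measurable (fun τ => heat τ G x) := by
  unfold heat heatKernel
  refine (StronglyMeasurable.integral_prod_right (f := fun τ y => _) ?_).measurable
  apply Measurable.stronglyMeasurable
  unfold Function.uncurry
  fun_prop

theorem abs_heat_le {d : ℕ} {τ : ℝ} (hτ : 0 < τ) {G : (Fin d → ℝ) → ℝ} {B : ℝ}
    (hB : ∀ y, |G y| ≤ B) (x : Fin d → ℝ) : |heat τ G x| ≤ B := by
  rw [heat_eq hτ, ← Real.norm_eq_abs]
  refine (norm_integral_le_of_norm_le ((integrable_heatKernel one_pos 0).const_mul B)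
    (ae_of_all _ fun z => ?_)).trans_eq ?_
  · rw [norm_mul, Real.norm_of_nonneg (heatKernel_pos one_pos _ _).le]
    exact mul_le_mul_of_nonneg_right (hB _) (heatKernel_pos one_pos _ _).le
  · rw [integral_const_mul, integral_heatKernel_one, mul_one]

theorem tendsto_heat {d : ℕ} {G : (Fin d → ℝ) → ℝ} (hG : Continuous G) {B : ℝ}
    (hB : ∀ y, |G y| ≤ B) (x : Fin d → ℝ) :
    Tendsto (fun τ => heat τ G x) (nhdsWithin 0 (Set.Ioi 0)) (nhds (G x)) := by
  have h : Tendsto (fun τ => ∫ z, G (x + √τ • z) * heatKernel 1 0 z)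
      (nhdsWithin 0 (Set.Ioi 0)) (nhds (∫ z : Fin d → ℝ, G x * heatKernel 1 0 z)) := by
    refine tendsto_integral_filter_of_dominated_convergence (fun z => B * heatKernel 1 0 z)
      (Eventually.of_forall fun τ => Continuous.aestronglyMeasurable
        (by have := continuous_heatKernel (d := d) 1 0; fun_prop))
      (Eventually.of_forall fun τ => ae_of_all _ fun z => ?_)
      ((integrable_heatKernel one_pos 0).const_mul B) (ae_of_all _ fun z => ?_)
    · rw [norm_mul, Real.norm_of_nonneg (heatKernel_pos one_pos _ _).le]
      exact mul_le_mul_of_nonneg_right (hB _) (heatKernel_pos one_pos _ _).le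
    · have hc : Continuous fun τ : ℝ => G (x + √τ • z) * heatKernel 1 0 z := by fun_prop
      have := hc.tendsto 0
      simp only [sqrt_zero, zero_smul, add_zero] at this
      exact this.mono_left nhdsWithin_le_nhds
  rw [integral_const_mul, integral_heatKernel_one, mul_one] at h
  refine h.congr' ?_
  filter_upwards [self_mem_nhdsWithin] with τ hτ using (heat_eq hτ G x).symm

/-- The heat semigroup commutes with partial derivatives. -/
theorem heat_hasPd_of_hasPd {d : ℕ} (k : Fin d) {τ : ℝ} (hτ : 0 < τ) {G G' : (Fin d → ℝ) → ℝ}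
    (hG : Measurable G) {B : ℝ} (hB : ∀ y, |G y| ≤ B) (hG' : Measurable G') {B' : ℝ}
    (hB' : ∀ y, |G' y| ≤ B') (hd : ∀ x, HasPd k G (G' x) x) (x : Fin d → ℝ) :
    HasPd k (heat τ G) (heat τ G' x) x := by
  have hρ := (continuous_heatKernel (d := d) 1 0).measurable
  have hup : ∀ h (z : Fin d → ℝ), Function.update x k h + √τ • z =
      Function.update (x + √τ • z) k (h + √τ * z k) := by
    intro h z
    ext i
    by_cases hi : i = k
    · subst hi; simp
    · simp [Function.update_of_ne hi]
  unfold HasPd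
  simp_rw [heat_eq hτ]
  refine ((hasDerivAt_integral_of_dominated_loc_of_deriv_le (x₀ := x k)
    (F := fun h z => G (Function.update x k h + √τ • z) * heatKernel 1 0 z)
    (F' := fun h z => G' (Function.update x k h + √τ • z) * heatKernel 1 0 z)
    (bound := fun z => B' * heatKernel 1 0 z) Filter.univ_mem
    (Eventually.of_forall fun h => ?_) ?_ ?_ (ae_of_all _ fun z h _ => ?_)
    ((integrable_heatKernel one_pos 0).const_mul B') (ae_of_all _ fun z h _ => ?_)).2).congr_deriv ?_
  · exact ((hG.comp (by fun_prop)).mul hρ).aestronglyMeasurable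
  · exact (integrable_heatKernel one_pos 0).bdd_mul
      (hG.comp (by fun_prop)).aestronglyMeasurable (ae_of_all _ fun z => hB _)
  · exact ((hG'.comp (by fun_prop)).mul hρ).aestronglyMeasurable
  · rw [norm_mul, Real.norm_of_nonneg (heatKernel_pos one_pos _ _).le]
    exact mul_le_mul_of_nonneg_right (hB' _) (heatKernel_pos one_pos _ _).le
  · refine HasDerivAt.mul_const ?_ _
    simp_rw [hup]
    have h1 := (hd (Function.update (x + √τ • z) k (h + √τ * z k))).hasDerivAt_update
    have h2 := h1.comp_add_const
    exact h2
  · simp only [Function.update_eq_self]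

theorem heat_deriv_eq {d : ℕ} (k : Fin d) {τ : ℝ} (hτ : 0 < τ) {G : (Fin d → ℝ) → ℝ}
    (hG : Measurable G) {B : ℝ} (hB : ∀ y, |G y| ≤ B) (x : Fin d → ℝ) :
    (heat τ (fun y => y k * G y) x - x k * heat τ G x) / τ =
      (√τ)⁻¹ * ∫ z, G (x + √τ • z) * z k * heatKernel 1 0 z := by
  have hi := integrable_mul_heatKernel hτ hG hB
  have e : heat τ (fun y => y k * G y) x - x k * heat τ G x =
      ∫ y, (G y * (y k - x k)) * heatKernel τ x y := by
    unfold heat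
    rw [← integral_const_mul, ← integral_sub (heat_hasPd k hτ hi x).1 ((hi x).const_mul _)]
    exact integral_congr_ae (ae_of_all _ fun y => by simp only; ring)
  rw [e, integral_mul_heatKernel hτ, div_eq_inv_mul]
  simp only [Pi.add_apply, Pi.smul_apply, smul_eq_mul, add_sub_cancel_left]
  rw [← integral_const_mul, ← integral_const_mul]
  refine integral_congr_ae (ae_of_all _ fun z => ?_)
  have : τ⁻¹ * √τ = (√τ)⁻¹ := by
    nth_rewrite 1 [← mul_self_sqrt hτ.le]
    have := (sqrt_pos.2 hτ).ne'
    field_simp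
  simp only
  rw [← this]
  ring

theorem heat_deriv2_eq {d : ℕ} (k : Fin d) {τ : ℝ} (hτ : 0 < τ) {G : (Fin d → ℝ) → ℝ}
    (hG : Measurable G) {B : ℝ} (hB : ∀ y, |G y| ≤ B) (x : Fin d → ℝ) :
    (∫ y, G y * ((y k - x k) ^ 2 * heatKernel τ x y)) / τ ^ 2 - heat τ G x / τ =
      τ⁻¹ * ∫ z, G (x + √τ • z) * ((z k ^ 2 - 1) * heatKernel 1 0 z) := by
  have hi := integrable_mul_heatKernel hτ hG hB
  have e : (∫ y, G y * ((y k - x k) ^ 2 * heatKernel τ x y)) / τ ^ 2 - heat τ G x / τ =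
      ∫ y, (G y * ((y k - x k) ^ 2 / τ ^ 2 - 1 / τ)) * heatKernel τ x y := by
    unfold heat
    rw [← integral_div, ← integral_div, ← integral_sub
      ((heat_hasPd_hasPd k hτ hi x).1.div_const _) ((hi x).div_const _)]
    exact integral_congr_ae (ae_of_all _ fun y => by simp only; ring)
  rw [e, integral_mul_heatKernel hτ, ← integral_const_mul]
  refine integral_congr_ae (ae_of_all _ fun z => ?_)
  simp only [Pi.add_apply, Pi.smul_apply, smul_eq_mul, add_sub_cancel_left]
  rw [mul_pow, sq_sqrt hτ.le]
  field_simp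

theorem integral_sq_sub_one_mul_heatKernel {d : ℕ} (k : Fin d) :
    ∫ z : Fin d → ℝ, (z k ^ 2 - 1) * heatKernel 1 0 z = 0 := by
  have hB : ∀ y : Fin d → ℝ, |(fun _ => (1 : ℝ)) y| ≤ 1 := by simp
  have hm : Measurable (fun _ : Fin d → ℝ => (1 : ℝ)) := measurable_const
  have hi := integrable_mul_heatKernel one_pos hm hB
  have h1 := heat_hasPd k one_pos hi
  have h2 := (heat_hasPd_hasPd k one_pos hi 0).2
  have hc : ∀ x : Fin d → ℝ, heat 1 (fun _ => (1 : ℝ)) x = 1 := fun x => by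
    rw [heat_eq one_pos]; simp [integral_heatKernel_one]
  have h3 : ∀ x : Fin d → ℝ, (heat 1 (fun y => y k * (fun _ => (1 : ℝ)) y) x -
      x k * heat 1 (fun _ => 1) x) / 1 = 0 := fun x => by
    rw [← (h1 x).2.pd, funext hc]
    simp [pd]
  have h4 := h2.pd
  rw [funext h3, heat_deriv2_eq k one_pos hm hB] at h4
  simpa [pd] using h4.symm

theorem exists_abs_heat_deriv_le (d : ℕ) : ∃ C : ℝ, 0 ≤ C ∧ ∀ (k : Fin d) (τ : ℝ), 0 < τ →
    ∀ (G : (Fin d → ℝ) → ℝ), Measurable G → ∀ B, (∀ y, |G y| ≤ B) → ∀ x,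
    |(heat τ (fun y => y k * G y) x - x k * heat τ G x) / τ| ≤ B * C * τ ^ (-1 / 2 : ℝ) := by
  refine ⟨∫ z : Fin d → ℝ, (1 + ∑ k, z k ^ 2) ^ 2 * heatKernel 1 0 z,
    integral_nonneg fun z => mul_nonneg (sq_nonneg _) (heatKernel_pos one_pos _ _).le,
    fun k τ hτ G hG B hB x => ?_⟩
  have hB0 : 0 ≤ B := (abs_nonneg _).trans (hB 0)
  rw [heat_deriv_eq k hτ hG hB, abs_mul, abs_of_pos (by positivity), mul_comm]
  have : (√τ)⁻¹ = τ ^ (-1 / 2 : ℝ) := by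
    rw [sqrt_eq_rpow, ← rpow_neg hτ.le]; norm_num
  rw [this]
  refine mul_le_mul_of_nonneg_right ?_ (by positivity)
  rw [← integral_const_mul, ← Real.norm_eq_abs]
  refine norm_integral_le_of_norm_le (integrable_sq_mul_heatKernel.const_mul B)
    (ae_of_all _ fun z => ?_)
  rw [norm_mul, norm_mul, Real.norm_of_nonneg (heatKernel_pos one_pos _ _).le, mul_assoc]
  have h1 : ‖z k‖ ≤ (1 + ∑ k, z k ^ 2) ^ 2 := by
    have h2 : z k ^ 2 ≤ ∑ k, z k ^ 2 :=
      Finset.single_le_sum (f := fun k => z k ^ 2) (fun i _ => sq_nonneg _) (mem_univ k)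
    rw [Real.norm_eq_abs]
    nlinarith [sq_abs (z k), sq_nonneg (|z k| - 1), sq_nonneg (z k), abs_nonneg (z k)]
  have := hB (x + √τ • z)
  have := (heatKernel_pos one_pos 0 z).le
  gcongr
  exact hB _

theorem rpow_norm_le {d : ℕ} {α : ℝ} (hα : 0 < α) (hα1 : α ≤ 1) (z : Fin d → ℝ) :
    ‖z‖ ^ α ≤ 1 + ∑ k, z k ^ 2 := by
  have h0 : 0 ≤ ∑ k, z k ^ 2 := Finset.sum_nonneg fun k _ => sq_nonneg _
  have h1 : ‖z‖ ^ 2 ≤ ∑ k, z k ^ 2 := by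
    have : ‖z‖ ≤ √(∑ k, z k ^ 2) := by
      rw [pi_norm_le_iff_of_nonneg (sqrt_nonneg _)]
      intro k
      rw [Real.norm_eq_abs]
      refine abs_le_sqrt ?_
      exact Finset.single_le_sum (f := fun k => z k ^ 2) (fun i _ => sq_nonneg _) (mem_univ k)
    calc ‖z‖ ^ 2 ≤ √(∑ k, z k ^ 2) ^ 2 := by gcongr
      _ = _ := sq_sqrt h0
  rcases le_total ‖z‖ 1 with h | h
  · have := rpow_le_one (norm_nonneg z) h hα.le
    linarith
  · have : ‖z‖ ^ α ≤ ‖z‖ ^ (1 : ℝ) := rpow_le_rpow_of_exponent_le h hα1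
    rw [rpow_one] at this
    nlinarith

theorem exists_abs_heat_deriv2_le (d : ℕ) : ∃ C : ℝ, 0 ≤ C ∧ ∀ (k : Fin d) (τ : ℝ), 0 < τ →
    ∀ (G : (Fin d → ℝ) → ℝ), Measurable G → ∀ B, (∀ y, |G y| ≤ B) →
    ∀ H α : ℝ, 0 ≤ H → 0 < α → α ≤ 1 → (∀ x y, |G x - G y| ≤ H * dist x y ^ α) → ∀ x,
    |(∫ y, G y * ((y k - x k) ^ 2 * heatKernel τ x y)) / τ ^ 2 - heat τ G x / τ| ≤
      H * C * τ ^ (α / 2 - 1) := by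
  refine ⟨∫ z : Fin d → ℝ, (1 + ∑ k, z k ^ 2) ^ 2 * heatKernel 1 0 z,
    integral_nonneg fun z => mul_nonneg (sq_nonneg _) (heatKernel_pos one_pos _ _).le,
    fun k τ hτ G hG B hB H α hH hα hα1 hHol x => ?_⟩
  have hq : ∀ z : Fin d → ℝ, |z k ^ 2 - 1| ≤ 1 + ∑ k, z k ^ 2 := fun z => by
    have h2 : z k ^ 2 ≤ ∑ k, z k ^ 2 :=
      Finset.single_le_sum (f := fun k => z k ^ 2) (fun i _ => sq_nonneg _) (mem_univ k)
    rw [abs_le]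
    constructor <;> nlinarith [sq_nonneg (z k)]
  have hS : ∀ z : Fin d → ℝ, 0 ≤ ∑ k, z k ^ 2 := fun z => Finset.sum_nonneg fun k _ => sq_nonneg _
  have hi : Integrable fun z : Fin d → ℝ => (z k ^ 2 - 1) * heatKernel 1 0 z :=
    integrable_poly_mul_heatKernel (C := 1) (by fun_prop) fun z => by nlinarith [hq z, hS z]
  have hiG : Integrable fun z : Fin d → ℝ =>
      G (x + √τ • z) * ((z k ^ 2 - 1) * heatKernel 1 0 z) :=
    hi.bdd_mul (hG.comp (by fun_prop)).aestronglyMeasurable (ae_of_all _ fun z => hB _)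
  have e : ∫ z, G (x + √τ • z) * ((z k ^ 2 - 1) * heatKernel 1 0 z) =
      ∫ z, (G (x + √τ • z) - G x) * ((z k ^ 2 - 1) * heatKernel 1 0 z) := by
    simp_rw [sub_mul (G _)]
    rw [integral_sub hiG (hi.const_mul _), integral_const_mul,
      integral_sq_sub_one_mul_heatKernel, mul_zero, sub_zero]
  have hτα : τ ^ (α / 2 - 1) = τ⁻¹ * √τ ^ α := by
    rw [sqrt_eq_rpow, ← rpow_mul hτ.le, ← rpow_neg_one, ← rpow_add hτ]
    congr 1
    ring
  rw [heat_deriv2_eq k hτ hG hB, e, abs_mul, abs_of_pos (by positivity), hτα, mul_left_comm]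
  refine mul_le_mul_of_nonneg_left ?_ (by positivity)
  rw [mul_right_comm, ← integral_const_mul, ← Real.norm_eq_abs]
  refine norm_integral_le_of_norm_le (integrable_sq_mul_heatKernel.const_mul _)
    (ae_of_all _ fun z => ?_)
  rw [norm_mul, norm_mul, Real.norm_of_nonneg (heatKernel_pos one_pos _ _).le, ← mul_assoc,
    ← mul_assoc]
  refine mul_le_mul_of_nonneg_right ?_ (heatKernel_pos one_pos _ _).le
  have h1 : ‖G (x + √τ • z) - G x‖ ≤ H * √τ ^ α * (1 + ∑ k, z k ^ 2) := by
    refine (hHol _ _).trans ?_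
    rw [dist_eq_norm, add_sub_cancel_left, norm_smul, Real.norm_of_nonneg (sqrt_nonneg _),
      mul_rpow (sqrt_nonneg _) (norm_nonneg _), ← mul_assoc]
    exact mul_le_mul_of_nonneg_left (rpow_norm_le hα hα1 z) (by positivity)
  calc _ ≤ (H * √τ ^ α * (1 + ∑ k, z k ^ 2)) * (1 + ∑ k, z k ^ 2) := by
        have := hS z
        exact mul_le_mul h1 (hq z) (norm_nonneg _) (by positivity)
    _ = _ := by ring


theorem HasPd.abs_update_sub_le {m : ℕ} {k : Fin m} {G : (Fin m → ℝ) → ℝ}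
    {G' : (Fin m → ℝ) → ℝ} (hG : ∀ x, HasPd k G (G' x) x) {B : ℝ} (hB : ∀ x, |G' x| ≤ B)
    (x : Fin m → ℝ) (a b : ℝ) :
    |G (Function.update x k a) - G (Function.update x k b)| ≤ B * |a - b| := by
  have h : ∀ h, HasDerivAt (fun h => G (Function.update x k h)) (G' (Function.update x k h)) h :=
    fun h => (hG _).hasDerivAt_update
  exact Convex.norm_image_sub_le_of_norm_deriv_le (s := Set.univ) (fun h' _ => (h h').differentiableAt)
    (fun h' _ => by rw [(h h').deriv]; exact hB _) convex_univ (Set.mem_univ b) (Set.mem_univ a)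

theorem continuous_of_hasPd_bounded {m : ℕ} {G : (Fin m → ℝ) → ℝ}
    {G' : Fin m → (Fin m → ℝ) → ℝ} (hG : ∀ k x, HasPd k G (G' k x) x) {B : ℝ}
    (hB : ∀ k x, |G' k x| ≤ B) : Continuous G := by
  have key : ∀ (x y : Fin m → ℝ) (S : Finset (Fin m)),
      |G (S.piecewise x y) - G y| ≤ ∑ i ∈ S, B * |x i - y i| := by
    intro x y S
    induction S using Finset.induction with
    | empty => simp
    | insert j S hj ih =>
      rw [Finset.piecewise_insert, Finset.sum_insert hj]
      have h := HasPd.abs_update_sub_le (hG j) (hB j) (S.piecewise x y) (x j) (y j)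
      have e : Function.update (S.piecewise x y) j (y j) = S.piecewise x y := by
        rw [Function.update_eq_self_iff, Finset.piecewise_eq_of_notMem _ _ _ hj]
      rw [e] at h
      exact (abs_sub_le _ _ _).trans (add_le_add h ih)
  rw [continuous_iff_continuousAt]
  intro y
  have h0 : Tendsto (fun x : Fin m → ℝ => ∑ i, B * |x i - y i|) (nhds y) (nhds 0) := by
    have hc : Continuous fun x : Fin m → ℝ => ∑ i, B * |x i - y i| := by fun_prop
    simpa using hc.tendsto y
  refine tendsto_iff_norm_sub_tendsto_zero.2 (squeeze_zero (fun _ => norm_nonneg _) (fun x => ?_) h0)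
  simpa using key x y univ

theorem abs_pd_le_of_bounded {m : ℕ} {k : Fin m} {G G' G'' : (Fin m → ℝ) → ℝ}
    (hG : ∀ x, HasPd k G (G' x) x) (hG' : ∀ x, HasPd k G' (G'' x) x) {M M₂ : ℝ}
    (hM : ∀ x, |G x| ≤ M) (hM₂ : ∀ x, |G'' x| ≤ M₂) (x : Fin m → ℝ) : |G' x| ≤ 2 * M + M₂ := by
  have h : ∀ h, HasDerivAt (fun h => G (Function.update x k h)) (G' (Function.update x k h)) h :=
    fun h => (hG _).hasDerivAt_update
  obtain ⟨c, hc, hc'⟩ := exists_hasDerivAt_eq_slope (fun h => G (Function.update x k h))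
    (fun h => G' (Function.update x k h)) (show x k < x k + 1 by linarith)
    (fun c _ => (h c).continuousAt.continuousWithinAt) (fun c _ => h c)
  have h1 := HasPd.abs_update_sub_le hG' hM₂ x c (x k)
  rw [Function.update_eq_self] at h1 hc'
  have hc2 : |c - x k| ≤ 1 := by rw [abs_le]; constructor <;> linarith [hc.1, hc.2]
  have h20 : 0 ≤ M₂ := (abs_nonneg _).trans (hM₂ x)
  have h2 : |G' (Function.update x k c) - G' x| ≤ M₂ := h1.trans (by nlinarith)
  rw [add_sub_cancel_left, div_one] at hc'
  rw [hc'] at h2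
  have h3 := hM x
  have h4 := hM (Function.update x k (x k + 1))
  rw [abs_le] at *
  constructor <;> linarith [h2.1, h2.2, h3.1, h3.2, h4.1, h4.2]

theorem continuous_of_abs_sub_le_rpow {X : Type*} [PseudoMetricSpace X] {G : X → ℝ} {H α : ℝ}
    (hα : 0 < α) (hG : ∀ x y, |G x - G y| ≤ H * dist x y ^ α) : Continuous G := by
  rw [continuous_iff_continuousAt]
  intro y
  have h0 : Tendsto (fun x : X => H * dist x y ^ α) (nhds y) (nhds 0) := by
    have hc : Continuous fun x : X => H * dist x y ^ α :=
      continuous_const.mul ((continuous_id.dist continuous_const).rpow_const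
        fun _ => Or.inr hα.le)
    simpa [zero_rpow hα.ne'] using hc.tendsto y
  exact tendsto_iff_norm_sub_tendsto_zero.2
    (squeeze_zero (fun _ => norm_nonneg _) (fun x => hG x y) h0)

theorem Kbm_eq (t s : ℝ) :
    Kbm t s = (2 * π * t) ^ (-(1 : ℝ) / 2) * exp (-(1 / (2 * t)) * s ^ 2) := by
  unfold Kbm
  congr 2
  ring

theorem Kbm_pos {t : ℝ} (ht : 0 < t) (s : ℝ) : 0 < Kbm t s := by
  unfold Kbm; positivity

theorem continuous_Kbm (t : ℝ) : Continuous (Kbm t) := by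
  unfold Kbm; fun_prop

theorem integrableOn_rpow_mul_Kbm {t : ℝ} (ht : 0 < t) {e : ℝ} (he : -1 < e) :
    IntegrableOn (fun s => s ^ e * Kbm t s) (Set.Ioi 0) := by
  have := (integrable_rpow_mul_exp_neg_mul_sq (b := 1 / (2 * t)) (by positivity) he).const_mul
    ((2 * π * t) ^ (-(1 : ℝ) / 2))
  refine (this.congr (ae_of_all _ fun s => ?_)).integrableOn
  simp only [Kbm_eq]
  ring

theorem integral_rpow_mul_Kbm {t : ℝ} (ht : 0 < t) {q : ℝ} (hq : -1 < q) :
    ∫ s in Set.Ioi 0, s ^ q * Kbm t s =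
      (2 * t) ^ (q / 2) * Gamma ((q + 1) / 2) / (2 * √π) := by
  have h := integral_rpow_mul_exp_neg_mul_rpow (p := 2) (q := q) (b := 1 / (2 * t)) two_pos hq
    (by positivity)
  simp_rw [rpow_two] at h
  simp_rw [Kbm_eq, mul_left_comm _ ((2 * π * t) ^ (-(1 : ℝ) / 2))]
  rw [integral_const_mul, h]
  have h1 : (2 * π * t) ^ (-(1 : ℝ) / 2) = (2 * t) ^ (-(1 : ℝ) / 2) * (√π)⁻¹ := by
    rw [show 2 * π * t = 2 * t * π by ring, mul_rpow (by positivity) pi_pos.le, sqrt_eq_rpow,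
      ← rpow_neg pi_pos.le]
    congr 2; norm_num
  have h2 : (1 / (2 * t)) ^ (-(q + 1) / 2) = (2 * t) ^ ((q + 1) / 2) := by
    rw [one_div, inv_rpow (by positivity), ← rpow_neg (by positivity)]
    congr 1; ring
  have h3 : (2 * t) ^ (q / 2) = (2 * t) ^ (-(1 : ℝ) / 2) * (2 * t) ^ ((q + 1) / 2) := by
    rw [← rpow_add (by positivity)]
    congr 1; ring
  rw [h1, h2, h3]
  field_simp

theorem integral_Kbm {t : ℝ} (ht : 0 < t) : ∫ s in Set.Ioi 0, Kbm t s = 1 / 2 := by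
  have h := integral_rpow_mul_Kbm ht (q := 0) (by norm_num)
  simp only [rpow_zero, one_mul, zero_add, zero_div, Gamma_one_half_eq] at h
  rw [h]
  field_simp

theorem integral_mul_Kbm {t : ℝ} (ht : 0 < t) :
    ∫ s in Set.Ioi 0, s * Kbm t s = √(t / (2 * π)) := by
  have h := integral_rpow_mul_Kbm ht (q := 1) (by norm_num)
  simp only [rpow_one, one_add_one_eq_two, div_self (two_ne_zero' ℝ), Gamma_one, mul_one] at h
  rw [h, ← sqrt_eq_rpow]
  rw [show t / (2 * π) = (2 * t) / (2 ^ 2 * π) by field_simp, sqrt_div (by positivity),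
    sqrt_mul (x := 2 ^ 2) (by positivity), sqrt_sq (by positivity)]

theorem integral_sq_mul_Kbm_one : ∫ s in Set.Ioi 0, s ^ 2 * Kbm 1 s = 1 / 2 := by
  have h := integral_rpow_mul_Kbm one_pos (q := 2) (by norm_num)
  simp only [rpow_two, mul_one, div_self (two_ne_zero' ℝ), rpow_one] at h
  rw [h, show ((2 : ℝ) + 1) / 2 = 1 / 2 + 1 by norm_num, Gamma_add_one (by norm_num),
    Gamma_one_half_eq]
  field_simp

/-- Lebesgue measure on the open positive orthant. -/
abbrev orthant (n : ℕ) : Measure (Fin n → ℝ) :=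
  (volume : Measure (Fin n → ℝ)).restrict {s | ∀ i, 0 < s i}

theorem orthant_eq_pi (n : ℕ) :
    orthant n = Measure.pi fun _ : Fin n => (volume : Measure ℝ).restrict (Set.Ioi 0) := by
  have : {s : Fin n → ℝ | ∀ i, 0 < s i} = Set.univ.pi fun _ => Set.Ioi 0 := by ext; simp
  rw [← Measure.restrict_pi_pi, ← volume_pi, orthant, this]

theorem measurableSet_orthant (n : ℕ) : MeasurableSet {s : Fin n → ℝ | ∀ i, 0 < s i} := by
  have : {s : Fin n → ℝ | ∀ i, 0 < s i} = Set.univ.pi fun _ => Set.Ioi 0 := by ext; simp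
  rw [this]
  exact MeasurableSet.univ_pi fun _ => measurableSet_Ioi

theorem ae_orthant (n : ℕ) {p : (Fin n → ℝ) → Prop} (h : ∀ s, (∀ i, 0 < s i) → p s) :
    ∀ᵐ s ∂orthant n, p s :=
  (ae_restrict_iff' (measurableSet_orthant n)).2 (ae_of_all _ h)

theorem integrable_orthant_prod {n : ℕ} {t : Fin n → ℝ} (ht : ∀ i, 0 < t i) {e : Fin n → ℝ}
    (he : ∀ i, -1 < e i) :
    Integrable (fun s => (∏ i, s i ^ e i) * ∏ i, Kbm (t i) (s i)) (orthant n) := by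
  rw [orthant_eq_pi]
  simp_rw [← Finset.prod_mul_distrib]
  exact Integrable.fintype_prod (f := fun i s => s ^ e i * Kbm (t i) s)
    fun i => integrableOn_rpow_mul_Kbm (ht i) (he i)

theorem integral_orthant_prod {n : ℕ} (F : Fin n → ℝ → ℝ) :
    ∫ s, ∏ i, F i (s i) ∂orthant n = ∏ i, ∫ s in Set.Ioi 0, F i s := by
  rw [orthant_eq_pi]
  exact integral_fintype_prod_eq_prod F

theorem Kbm_sqrt_mul {t : ℝ} (ht : 0 < t) (r : ℝ) : √t * Kbm t (√t * r) = Kbm 1 r := by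
  unfold Kbm
  rw [mul_rpow (by positivity) ht.le, mul_pow, sq_sqrt ht.le, mul_one, mul_one]
  have : √t * t ^ (-(1 : ℝ) / 2) = 1 := by
    rw [sqrt_eq_rpow, ← rpow_add ht]; norm_num
  rw [show -(t * r ^ 2) / (2 * t) = -r ^ 2 / 2 by field_simp]
  calc _ = (√t * t ^ (-(1 : ℝ) / 2)) * ((2 * π) ^ (-(1 : ℝ) / 2) * exp (-r ^ 2 / 2)) := by ring
    _ = _ := by rw [this, one_mul]

/-- Brownian scaling on the positive orthant. -/
theorem integral_orthant_scale {n : ℕ} {t : Fin n → ℝ} (ht : ∀ i, 0 < t i)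
    (F : (Fin n → ℝ) → ℝ) :
    ∫ s, F s * ∏ i, Kbm (t i) (s i) ∂orthant n =
      ∫ r, F (fun i => √(t i) * r i) * ∏ i, Kbm 1 (r i) ∂orthant n := by
  have hs : ∀ i, 0 < √(t i) := fun i => sqrt_pos.2 (ht i)
  have hdet : (Matrix.diagonal fun i => √(t i)).det = ∏ i, √(t i) := Matrix.det_diagonal
  have hpos : 0 < ∏ i, √(t i) := Finset.prod_pos fun i _ => hs i
  have hmap := Real.smul_map_diagonal_volume_pi (D := fun i => √(t i)) (by rw [hdet]; exact hpos.ne')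
  have hT : ⇑(Matrix.toLin' (Matrix.diagonal fun i => √(t i))) =
      fun (r : Fin n → ℝ) i => √(t i) * r i := by
    ext r i
    simp [Matrix.toLin'_apply, Matrix.mulVec_diagonal]
  rw [hT, hdet, abs_of_pos hpos] at hmap
  have hemb : MeasurableEmbedding fun (r : Fin n → ℝ) i => √(t i) * r i := by
    refine Continuous.measurableEmbedding (by fun_prop) fun a b hab => ?_
    ext i
    exact mul_left_cancel₀ (hs i).ne' (congrFun hab i)
  have hset := measurableSet_orthant n
  unfold orthant
  rw [← integral_indicator hset, ← integral_indicator hset]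
  nth_rewrite 1 [← hmap]
  rw [integral_smul_measure, hemb.integral_map, ENNReal.toReal_ofReal hpos.le, smul_eq_mul,
    ← integral_const_mul]
  refine integral_congr_ae (ae_of_all _ fun r => ?_)
  have hiff : (fun i => √(t i) * r i) ∈ {s : Fin n → ℝ | ∀ i, 0 < s i} ↔
      r ∈ {s : Fin n → ℝ | ∀ i, 0 < s i} :=
    forall_congr' fun i => mul_pos_iff_of_pos_left (hs i)
  by_cases hr : r ∈ {s : Fin n → ℝ | ∀ i, 0 < s i}
  · simp only [Set.indicator_of_mem hr, Set.indicator_of_mem (hiff.2 hr)]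
    rw [← Finset.prod_congr rfl fun i _ => Kbm_sqrt_mul (ht i) (r i), Finset.prod_mul_distrib]
    ring
  · simp only [Set.indicator_of_notMem hr, Set.indicator_of_notMem (mt hiff.1 hr), mul_zero]


theorem hasPd_integral {Ω : Type*} [MeasurableSpace Ω] {μ : Measure Ω} {d : ℕ} (k : Fin d)
    {Φ Ψ : Ω → (Fin d → ℝ) → ℝ} {b : Ω → ℝ} (hb : Integrable b μ)
    (hΦ : ∀ x, Integrable (fun ω => Φ ω x) μ) (hΨ : ∀ x, AEStronglyMeasurable (fun ω => Ψ ω x) μ)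
    (hle : ∀ᵐ ω ∂μ, ∀ x, |Ψ ω x| ≤ b ω) (hd : ∀ᵐ ω ∂μ, ∀ x, HasPd k (Φ ω) (Ψ ω x) x)
    (x : Fin d → ℝ) :
    Integrable (fun ω => Ψ ω x) μ ∧ HasPd k (fun x => ∫ ω, Φ ω x ∂μ) (∫ ω, Ψ ω x ∂μ) x := by
  have := hasDerivAt_integral_of_dominated_loc_of_deriv_le (μ := μ) (x₀ := x k)
    (F := fun h ω => Φ ω (Function.update x k h)) (F' := fun h ω => Ψ ω (Function.update x k h))
    (bound := b) Filter.univ_mem (Eventually.of_forall fun h => (hΦ _).aestronglyMeasurable)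
    (hΦ _) (hΨ _) (by filter_upwards [hle] with ω h a _ using h _) hb
    (by filter_upwards [hd] with ω h a _ using (h _).hasDerivAt_update)
  simpa only [HasPd, Function.update_eq_self] using this

theorem prod_erase_eq_succAbove {M : Type*} [CommMonoid M] {m : ℕ} (j : Fin (m + 1))
    (F : Fin (m + 1) → M) : ∏ i ∈ univ.erase j, F i = ∏ k, F (j.succAbove k) := by
  have : (univ.erase j : Finset (Fin (m + 1))) = univ.map j.succAboveEmb := by
    ext i
    simp [Fin.exists_succAbove_eq_iff]
  rw [this, Finset.prod_map]
  rfl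

theorem prod_erase_sq_mul_rpow {n : ℕ} (j : Fin n) (β : ℝ) {s : Fin n → ℝ} (hs : ∀ i, 0 < s i) :
    (∏ i ∈ univ.erase j, s i) ^ 2 * (∏ i, s i) ^ β =
      ∏ i, s i ^ (if i = j then β else β + 2) := by
  rw [← Real.finsetProd_rpow _ _ fun i _ => (hs i).le, ← Finset.mul_prod_erase _ _ (mem_univ j),
    ← Finset.mul_prod_erase univ (fun i => s i ^ (if i = j then β else β + 2)) (mem_univ j),
    mul_left_comm, ← Finset.prod_pow, ← Finset.prod_mul_distrib, if_pos rfl]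
  congr 1
  refine Finset.prod_congr rfl fun i hi => ?_
  rw [if_neg (Finset.ne_of_mem_erase hi), rpow_add (hs i), rpow_two, mul_comm]

theorem integrable_orthant_erase_sq {n : ℕ} (j : Fin n) {t : Fin n → ℝ} (ht : ∀ i, 0 < t i)
    {β : ℝ} (hβ : -1 < β) :
    Integrable (fun s => (∏ i ∈ univ.erase j, s i) ^ 2 * (∏ i, s i) ^ β *
      ∏ i, Kbm (t i) (s i)) (orthant n) := by
  refine (integrable_orthant_prod ht (e := fun i => if i = j then β else β + 2)
    fun i => ?_).congr (ae_orthant n fun s hs => ?_)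
  · split_ifs <;> linarith
  · simp only [prod_erase_sq_mul_rpow j β hs]

theorem prod_Kbm_pos {n : ℕ} {t : Fin n → ℝ} (ht : ∀ i, 0 < t i) (s : Fin n → ℝ) :
    0 < ∏ i, Kbm (t i) (s i) := Finset.prod_pos fun i _ => Kbm_pos (ht i) _

theorem measurable_prod_Kbm {n : ℕ} (t : Fin n → ℝ) :
    Measurable fun s : Fin n → ℝ => ∏ i, Kbm (t i) (s i) := by
  have := fun i => (continuous_Kbm (t i)).measurable
  fun_prop

theorem tendsto_integral_orthant {n : ℕ} {ι : Type*} {l : Filter ι} [l.IsCountablyGenerated]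
    {w : (Fin n → ℝ) → ℝ}
    (hw : Integrable (fun r => w r * ∏ i, Kbm 1 (r i)) (orthant n)) {φ : ℝ → ℝ}
    (hφ : Measurable φ) {M L : ℝ} (hM : ∀ τ, 0 < τ → |φ τ| ≤ M)
    (hL : Tendsto φ (nhdsWithin 0 (Set.Ioi 0)) (nhds L)) {c : ι → ℝ}
    (hc : Tendsto c l (nhdsWithin 0 (Set.Ioi 0))) :
    Tendsto (fun ε => ∫ r, w r * φ (c ε * ∏ i, r i) * ∏ i, Kbm 1 (r i) ∂orthant n) l
      (nhds (L * ∫ r, w r * ∏ i, Kbm 1 (r i) ∂orthant n)) := by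
  rw [← integral_const_mul]
  have hcpos : ∀ᶠ ε in l, 0 < c ε := hc.eventually self_mem_nhdsWithin
  refine tendsto_integral_filter_of_dominated_convergence
    (fun r => M * ‖w r * ∏ i, Kbm 1 (r i)‖) (Eventually.of_forall fun ε => ?_) ?_
    (hw.norm.const_mul M) (ae_orthant n fun r hr => ?_)
  · have h1 : Measurable fun r : Fin n → ℝ => φ (c ε * ∏ i, r i) := hφ.comp (by fun_prop)
    refine (h1.aestronglyMeasurable.mul hw.aestronglyMeasurable).congr (ae_of_all _ fun r => ?_)
    simp only [Pi.mul_apply]; ring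
  · filter_upwards [hcpos] with ε hε
    refine ae_orthant n fun r hr => ?_
    rw [mul_right_comm, mul_comm, norm_mul]
    exact mul_le_mul_of_nonneg_right (hM _ (mul_pos hε (Finset.prod_pos fun i _ => hr i)))
      (norm_nonneg _)
  · have hρ : 0 < ∏ i, r i := Finset.prod_pos fun i _ => hr i
    have h1 : Tendsto (fun ε => c ε * ∏ i, r i) l (nhdsWithin 0 (Set.Ioi 0)) := by
      refine tendsto_nhdsWithin_iff.2 ⟨?_, ?_⟩
      · simpa using (tendsto_nhds_of_tendsto_nhdsWithin hc).mul_const (∏ i, r i)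
      · filter_upwards [hcpos] with ε hε using mul_pos hε hρ
    have h2 := ((hL.comp h1).const_mul (w r)).mul_const (∏ i, Kbm 1 (r i))
    rwa [show w r * L * ∏ i, Kbm 1 (r i) = L * (w r * ∏ i, Kbm 1 (r i)) by ring] at h2

theorem hasDerivAt_integral_orthant {n : ℕ} {φ ψ : ℝ → ℝ} (hφ : Measurable φ) (hψ : Measurable ψ)
    {M B : ℝ} (hM : ∀ τ, 0 < τ → |φ τ| ≤ M) (hB : ∀ τ, 0 < τ → |ψ τ| ≤ B)
    (hd : ∀ τ, 0 < τ → HasDerivAt φ (1 / 2 * ψ τ) τ) {a h₀ : ℝ} (ha : 0 < a) (h₀pos : 0 < h₀) :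
    HasDerivAt (fun h => ∫ r, φ (√h * a * ∏ i, r i) * ∏ i, Kbm 1 (r i) ∂orthant n)
      (1 / 4 * ∫ r, ψ (√h₀ * a * ∏ i, r i) * ((√h₀ * a * ∏ i, r i) / h₀) *
        ∏ i, Kbm 1 (r i) ∂orthant n) h₀ := by
  have ht : ∀ i : Fin n, (0 : ℝ) < (fun _ => 1) i := fun _ => one_pos
  have hK := measurable_prod_Kbm (n := n) fun _ => 1
  have i0 : Integrable (fun r : Fin n → ℝ => ∏ i, Kbm 1 (r i)) (orthant n) := by
    have := integrable_orthant_prod ht (e := fun _ => 0) fun _ => by norm_num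
    simpa only [rpow_zero, Finset.prod_const_one, one_mul] using this
  have i1 : Integrable (fun r : Fin n → ℝ => (∏ i, r i) * ∏ i, Kbm 1 (r i)) (orthant n) := by
    have := integrable_orthant_prod ht (e := fun _ => 1) fun _ => by norm_num
    simpa only [rpow_one] using this
  have hm : ∀ (f : ℝ → ℝ), Measurable f → ∀ c, Measurable fun r : Fin n → ℝ => f (c * ∏ i, r i) :=
    fun f hf c => hf.comp (by fun_prop)
  have key := (hasDerivAt_integral_of_dominated_loc_of_deriv_le (μ := orthant n) (x₀ := h₀)
    (F := fun h r => φ (√h * a * ∏ i, r i) * ∏ i, Kbm 1 (r i))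
    (F' := fun h r => 1 / 4 * (ψ (√h * a * ∏ i, r i) * ((√h * a * ∏ i, r i) / h) *
        ∏ i, Kbm 1 (r i)))
    (bound := fun r => 1 / 4 * B * (a / √(h₀ / 2)) * ((∏ i, r i) * ∏ i, Kbm 1 (r i)))
    (Ioi_mem_nhds (half_lt_self h₀pos)) (Eventually.of_forall fun h => ?_) ?_ ?_
    (ae_orthant n fun r hr h hh => ?_) (i1.const_mul _) (ae_orthant n fun r hr h hh => ?_)).2
  · rwa [integral_const_mul] at key
  · exact ((hm φ hφ _).mul hK).aestronglyMeasurable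
  · refine (i0.const_mul M).mono' ((hm φ hφ _).mul hK).aestronglyMeasurable
      (ae_orthant n fun r hr => ?_)
    rw [norm_mul, Real.norm_of_nonneg (prod_Kbm_pos ht r).le]
    exact mul_le_mul_of_nonneg_right (hM _ (mul_pos (mul_pos (sqrt_pos.2 h₀pos) ha)
      (Finset.prod_pos fun i _ => hr i))) (prod_Kbm_pos ht r).le
  · have := hm ψ hψ (√h₀ * a)
    exact Measurable.aestronglyMeasurable (by fun_prop)
  · have hρ : 0 < ∏ i, r i := Finset.prod_pos fun i _ => hr i
    have hhp : 0 < h := lt_trans (half_pos h₀pos) hh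
    have hs : 0 < √h := sqrt_pos.2 hhp
    have hs0 : 0 < √(h₀ / 2) := sqrt_pos.2 (half_pos h₀pos)
    have hτ : 0 < √h * a * ∏ i, r i := by positivity
    have hk := prod_Kbm_pos ht r
    have hle : √(h₀ / 2) ≤ √h := sqrt_le_sqrt (le_of_lt hh)
    have e : (√h * a * ∏ i, r i) / h = a / √h * ∏ i, r i := by
      nth_rewrite 2 [← mul_self_sqrt hhp.le]
      field_simp
    rw [e]
    simp only [norm_mul, Real.norm_of_nonneg hk.le]
    rw [Real.norm_of_nonneg hρ.le, Real.norm_of_nonneg (by positivity : 0 ≤ a / √h),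
      Real.norm_of_nonneg (by norm_num : (0 : ℝ) ≤ 1 / 4)]
    have hb := hB _ hτ
    have hB0 : 0 ≤ B := (abs_nonneg _).trans hb
    calc 1 / 4 * (‖ψ (√h * a * ∏ i, r i)‖ * (a / √h * ∏ i, r i) * ∏ i, Kbm 1 (r i))
        ≤ 1 / 4 * (B * (a / √(h₀ / 2) * ∏ i, r i) * ∏ i, Kbm 1 (r i)) := by
          gcongr
          exact hb
      _ = _ := by ring
  · have hρ : 0 < ∏ i, r i := Finset.prod_pos fun i _ => hr i
    have hhp : 0 < h := lt_trans (half_pos h₀pos) hh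
    have hs : 0 < √h := sqrt_pos.2 hhp
    have h1 : HasDerivAt (fun h => √h * a * ∏ i, r i) (1 / (2 * √h) * a * ∏ i, r i) h :=
      ((hasDerivAt_sqrt hhp.ne').mul_const a).mul_const _
    have h2 := ((hd _ (by positivity : 0 < √h * a * ∏ i, r i)).comp h h1).mul_const
      (∏ i, Kbm 1 (r i))
    refine h2.congr_deriv ?_
    have e : (√h * a * ∏ i, r i) / h = a / √h * ∏ i, r i := by
      nth_rewrite 2 [← mul_self_sqrt hhp.le]
      field_simp
    rw [e]
    field_simp
    ring

theorem hasDerivAt_Kbm {t : ℝ} (s : ℝ) : HasDerivAt (Kbm t) (-(s / t) * Kbm t s) s := by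
  have h := ((((hasDerivAt_pow 2 s).fun_neg).div_const (2 * t)).exp).const_mul
    ((2 * π * t) ^ (-(1 : ℝ) / 2))
  refine h.congr_deriv ?_
  unfold Kbm
  rw [show -((2 : ℕ) * s ^ (2 - 1)) / (2 * t) = -(s / t) by simp; ring]
  ring

theorem tendsto_Kbm_atTop {t : ℝ} (ht : 0 < t) : Tendsto (Kbm t) atTop (nhds 0) := by
  have h : Tendsto (fun s : ℝ => s ^ 2 / (2 * t)) atTop atTop :=
    (tendsto_pow_atTop two_ne_zero).atTop_div_const (by positivity)
  have := (tendsto_exp_neg_atTop_nhds_zero.comp h).const_mul ((2 * π * t) ^ (-(1 : ℝ) / 2))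
  rw [mul_zero] at this
  refine this.congr fun s => ?_
  simp only [Kbm, Function.comp, neg_div]

theorem integral_Ioi_heat_by_parts {t a : ℝ} (ht : 0 < t) (ha : 0 < a) {ψ χ : ℝ → ℝ} {B g : ℝ}
    (hB : ∀ τ, 0 < τ → |ψ τ| ≤ B) (hd : ∀ τ, 0 < τ → HasDerivAt ψ (1 / 2 * χ τ) τ)
    (h0 : Tendsto ψ (nhdsWithin 0 (Set.Ioi 0)) (nhds g))
    (hint : IntegrableOn (fun s => (ψ (s * a) * (s / t) - 1 / 2 * a * χ (s * a)) * Kbm t s)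
      (Set.Ioi 0)) :
    ∫ s in Set.Ioi 0, (ψ (s * a) * (s / t) - 1 / 2 * a * χ (s * a)) * Kbm t s = g * Kbm t 0 := by
  set F : ℝ → ℝ := fun s => (if 0 < s then ψ (s * a) else g) * Kbm t s with hF
  have hcont : ContinuousWithinAt F (Set.Ici 0) 0 := by
    refine ContinuousWithinAt.mul ?_ (continuous_Kbm t).continuousWithinAt
    rw [← Set.Ioi_insert, continuousWithinAt_insert_self]
    unfold ContinuousWithinAt
    simp only [lt_irrefl, if_false]
    have h1 : Tendsto (fun s : ℝ => s * a) (nhdsWithin 0 (Set.Ioi 0))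
        (nhdsWithin 0 (Set.Ioi 0)) := by
      refine tendsto_nhdsWithin_iff.2 ⟨?_, ?_⟩
      · have hc : Continuous fun s : ℝ => s * a := by fun_prop
        have := hc.tendsto 0
        rw [zero_mul] at this
        exact this.mono_left nhdsWithin_le_nhds
      · filter_upwards [self_mem_nhdsWithin] with s hs using mul_pos hs ha
    refine (h0.comp h1).congr' ?_
    filter_upwards [self_mem_nhdsWithin] with s hs
    simp only [Function.comp, if_pos (show 0 < s from hs)]
  have hderiv : ∀ s ∈ Set.Ioi (0 : ℝ), HasDerivAt F
      (-((ψ (s * a) * (s / t) - 1 / 2 * a * χ (s * a)) * Kbm t s)) s := by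
    intro s hs
    have hs : 0 < s := hs
    have h1 : HasDerivAt (fun s => ψ (s * a)) (1 / 2 * χ (s * a) * a) s := by
      have := (hd _ (mul_pos hs ha)).comp s ((hasDerivAt_id s).mul_const a)
      exact this.congr_deriv (by ring)
    refine ((h1.mul (hasDerivAt_Kbm (t := t) s)).congr_deriv (by ring)).congr_of_eventuallyEq ?_
    filter_upwards [Ioi_mem_nhds hs] with s' hs'
    simp only [hF, Pi.mul_apply, if_pos (show 0 < s' from hs')]
  have hlim : Tendsto F atTop (nhds 0) := by
    have h1 := (tendsto_Kbm_atTop ht).const_mul B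
    rw [mul_zero] at h1
    refine squeeze_zero_norm' ?_ h1
    filter_upwards [eventually_gt_atTop 0] with s hs
    simp only [hF, if_pos hs]
    rw [norm_mul, Real.norm_of_nonneg (Kbm_pos ht s).le]
    exact mul_le_mul_of_nonneg_right (hB _ (mul_pos hs ha)) (Kbm_pos ht s).le
  have := integral_Ioi_of_hasDerivAt_of_tendsto hcont hderiv hint.neg hlim
  rw [integral_neg] at this
  simp only [hF, lt_irrefl, if_false] at this
  linarith

/-- Integration by parts in one coordinate of the orthant. -/
theorem integral_orthant_by_parts {m : ℕ} (j : Fin (m + 1)) {t : Fin (m + 1) → ℝ}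
    (ht : ∀ i, 0 < t i) {ψ χ : ℝ → ℝ} (hψ : Measurable ψ) (hχ : Measurable χ) {B C β g : ℝ}
    (hB : ∀ τ, 0 < τ → |ψ τ| ≤ B) (hC : ∀ τ, 0 < τ → |χ τ| ≤ C * τ ^ β) (hβ : -1 < β)
    (hd : ∀ τ, 0 < τ → HasDerivAt ψ (1 / 2 * χ τ) τ)
    (h0 : Tendsto ψ (nhdsWithin 0 (Set.Ioi 0)) (nhds g)) :
    ∫ s, ψ (∏ i, s i) * ((∏ i, s i) / t j) * ∏ i, Kbm (t i) (s i) ∂orthant (m + 1) =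
      g * Kbm (t j) 0 * (∏ i ∈ univ.erase j, √(t i / (2 * π))) +
      1 / 2 * ∫ s, (∏ i ∈ univ.erase j, s i) ^ 2 * χ (∏ i, s i) *
        ∏ i, Kbm (t i) (s i) ∂orthant (m + 1) := by
  have hK := measurable_prod_Kbm t
  have mψ : Measurable fun s : Fin (m + 1) → ℝ => ψ (∏ i, s i) := hψ.comp (by fun_prop)
  have mχ : Measurable fun s : Fin (m + 1) → ℝ => χ (∏ i, s i) := hχ.comp (by fun_prop)
  have i1 : Integrable (fun s : Fin (m + 1) → ℝ => ψ (∏ i, s i) * ((∏ i, s i) / t j) *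
      ∏ i, Kbm (t i) (s i)) (orthant (m + 1)) := by
    have h := integrable_orthant_prod ht (e := fun _ => 1) fun _ => by norm_num
    simp only [rpow_one] at h
    refine (h.const_mul (B / t j)).mono' (Measurable.aestronglyMeasurable (by fun_prop))
      (ae_orthant _ fun s hs => ?_)
    have hρ : 0 < ∏ i, s i := Finset.prod_pos fun i _ => hs i
    have hk := prod_Kbm_pos ht s
    have htj := ht j
    rw [norm_mul, norm_mul, Real.norm_of_nonneg hk.le,
      Real.norm_of_nonneg (by positivity : 0 ≤ (∏ i, s i) / t j)]
    have hB0 : 0 ≤ B := (abs_nonneg _).trans (hB _ hρ)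
    calc _ ≤ B * ((∏ i, s i) / t j) * ∏ i, Kbm (t i) (s i) := by
          gcongr
          exact hB _ hρ
      _ = _ := by ring
  have i2 : Integrable (fun s : Fin (m + 1) → ℝ => (∏ i ∈ univ.erase j, s i) ^ 2 * χ (∏ i, s i) *
      ∏ i, Kbm (t i) (s i)) (orthant (m + 1)) := by
    refine ((integrable_orthant_erase_sq j ht hβ).const_mul C).mono'
      (Measurable.aestronglyMeasurable (by fun_prop)) (ae_orthant _ fun s hs => ?_)
    have hρ : 0 < ∏ i, s i := Finset.prod_pos fun i _ => hs i
    have hk := prod_Kbm_pos ht s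
    rw [norm_mul, norm_mul, Real.norm_of_nonneg hk.le, Real.norm_of_nonneg (sq_nonneg _)]
    calc _ ≤ (∏ i ∈ univ.erase j, s i) ^ 2 * (C * (∏ i, s i) ^ β) * ∏ i, Kbm (t i) (s i) := by
          gcongr
          exact hC _ hρ
      _ = _ := by ring
  set D : (Fin (m + 1) → ℝ) → ℝ := fun s => ψ (∏ i, s i) * ((∏ i, s i) / t j) *
      (∏ i, Kbm (t i) (s i)) - 1 / 2 * ((∏ i ∈ univ.erase j, s i) ^ 2 * χ (∏ i, s i) *
      ∏ i, Kbm (t i) (s i)) with hD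
  have iD : Integrable D (orthant (m + 1)) := i1.sub (i2.const_mul _)
  suffices h : ∫ s, D s ∂orthant (m + 1) =
      g * Kbm (t j) 0 * (∏ i ∈ univ.erase j, √(t i / (2 * π))) by
    rw [hD, integral_sub i1 (i2.const_mul _), integral_const_mul] at h
    linarith
  have hmp := (measurePreserving_piFinSuccAbove
    (fun _ : Fin (m + 1) => (volume : Measure ℝ).restrict (Set.Ioi 0)) j).symm
  rw [← orthant_eq_pi (m + 1)] at hmp
  have hDe : ∀ (x : ℝ) (y : Fin m → ℝ),
      D ((MeasurableEquiv.piFinSuccAbove (fun _ : Fin (m + 1) => ℝ) j).symm (x, y)) =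
      ((∏ k, y k) * ∏ k, Kbm (t (j.succAbove k)) (y k)) *
      ((ψ (x * ∏ k, y k) * (x / t j) - 1 / 2 * (∏ k, y k) * χ (x * ∏ k, y k)) * Kbm (t j) x) := by
    intro x y
    simp only [hD, MeasurableEquiv.piFinSuccAbove_symm_apply, Fin.insertNthEquiv_apply,
      prod_erase_eq_succAbove, Fin.prod_univ_succAbove _ j, Fin.insertNth_apply_same,
      Fin.insertNth_apply_succAbove]
    ring
  have iDe : Integrable (fun z => D ((MeasurableEquiv.piFinSuccAbove
      (fun _ : Fin (m + 1) => ℝ) j).symm z)) _ := hmp.integrable_comp_of_integrable iD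
  rw [← hmp.integral_comp' D, integral_prod_symm _ iDe]
  have hae : ∀ᵐ y ∂(Measure.pi fun _ : Fin m => (volume : Measure ℝ).restrict (Set.Ioi 0)),
      (∫ x in Set.Ioi 0, D ((MeasurableEquiv.piFinSuccAbove (fun _ : Fin (m + 1) => ℝ) j).symm
        (x, y))) = g * Kbm (t j) 0 * ∏ k, y k * Kbm (t (j.succAbove k)) (y k) := by
    have hpos : ∀ᵐ y ∂(Measure.pi fun _ : Fin m => (volume : Measure ℝ).restrict (Set.Ioi 0)),
        ∀ i, 0 < y i := by
      rw [← orthant_eq_pi]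
      exact ae_orthant m fun s hs => hs
    filter_upwards [iDe.prod_left_ae, hpos] with y hy hypos
    have ha : 0 < ∏ k, y k := Finset.prod_pos fun i _ => hypos i
    have hk := prod_Kbm_pos (fun k => ht (j.succAbove k)) y
    simp only [hDe] at hy ⊢
    rw [integrable_const_mul_iff (IsUnit.mk0 _ (by positivity))] at hy
    rw [integral_const_mul, integral_Ioi_heat_by_parts (ht j) ha hB hd h0 hy,
      Finset.prod_mul_distrib]
    ring
  rw [integral_congr_ae hae, integral_const_mul, prod_erase_eq_succAbove]
  congr 1
  rw [integral_fintype_prod_eq_prod fun (k : Fin m) y => y * Kbm (t (j.succAbove k)) y]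
  exact Finset.prod_congr rfl fun k _ => integral_mul_Kbm (ht _)


/-- The second partial derivative in direction `k` of the heat semigroup, see
`heat_hasPd_hasPd`. -/
def heatHess {d : ℕ} (k : Fin d) (τ : ℝ) (G : (Fin d → ℝ) → ℝ) (x : Fin d → ℝ) : ℝ :=
  (∫ y, G y * ((y k - x k) ^ 2 * heatKernel τ x y)) / τ ^ 2 - heat τ G x / τ

theorem measurable_heatHess {d : ℕ} (k : Fin d) {G : (Fin d → ℝ) → ℝ} (hG : Measurable G)
    (x : Fin d → ℝ) : Measurable fun τ => heatHess k τ G x := by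
  have h1 := measurable_heat hG x
  have h2 : Measurable fun τ => heat τ (fun y => G y * (y k - x k) ^ 2) x :=
    measurable_heat (by fun_prop) x
  have e : (fun τ => heatHess k τ G x) = fun τ =>
      heat τ (fun y => G y * (y k - x k) ^ 2) x / τ ^ 2 - heat τ G x / τ := by
    funext τ
    simp only [heatHess, heat, mul_assoc]
  rw [e]
  fun_prop

theorem HasPd.unique {d : ℕ} {k : Fin d} {G : (Fin d → ℝ) → ℝ} {a b : ℝ} {x : Fin d → ℝ}
    (ha : HasPd k G a x) (hb : HasPd k G b x) : a = b := HasDerivAt.unique ha hb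

theorem HasPd.const_mul {d : ℕ} {k : Fin d} {G : (Fin d → ℝ) → ℝ} {a : ℝ} {x : Fin d → ℝ}
    (c : ℝ) (ha : HasPd k G a x) : HasPd k (fun x => c * G x) (c * a) x :=
  HasDerivAt.const_mul c ha

/-- Weighted integral over the orthant of a function of the product of the coordinates. -/
def weightedIntegral {n : ℕ} (j : Fin n) (t : Fin n → ℝ) (φ : ℝ → ℝ) : ℝ :=
  ∫ s, (∏ i ∈ univ.erase j, s i) ^ 2 * φ (∏ i, s i) * ∏ i, Kbm (t i) (s i) ∂orthant n

theorem abs_weighted_le {n : ℕ} (j : Fin n) {t : Fin n → ℝ} (ht : ∀ i, 0 < t i) {φ : ℝ → ℝ}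
    {C β : ℝ} (hφ : ∀ τ, 0 < τ → |φ τ| ≤ C * τ ^ β) {s : Fin n → ℝ} (hs : ∀ i, 0 < s i) :
    |(∏ i ∈ univ.erase j, s i) ^ 2 * φ (∏ i, s i) * ∏ i, Kbm (t i) (s i)| ≤
      C * ((∏ i ∈ univ.erase j, s i) ^ 2 * (∏ i, s i) ^ β * ∏ i, Kbm (t i) (s i)) := by
  have hk := prod_Kbm_pos ht s
  rw [abs_mul, abs_mul, abs_of_pos hk, abs_of_nonneg (sq_nonneg _)]
  calc _ ≤ (∏ i ∈ univ.erase j, s i) ^ 2 * (C * (∏ i, s i) ^ β) * ∏ i, Kbm (t i) (s i) := by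
        gcongr
        exact hφ _ (Finset.prod_pos fun i _ => hs i)
    _ = _ := by ring

theorem integrable_weighted {n : ℕ} (j : Fin n) {t : Fin n → ℝ} (ht : ∀ i, 0 < t i) {φ : ℝ → ℝ}
    (hm : Measurable φ) {C β : ℝ} (hβ : -1 < β) (hφ : ∀ τ, 0 < τ → |φ τ| ≤ C * τ ^ β) :
    Integrable (fun s => (∏ i ∈ univ.erase j, s i) ^ 2 * φ (∏ i, s i) * ∏ i, Kbm (t i) (s i))
      (orthant n) := by
  have h1 : Measurable fun s : Fin n → ℝ => φ (∏ i, s i) := hm.comp (by fun_prop)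
  have h2 := measurable_prod_Kbm t
  exact ((integrable_orthant_erase_sq j ht hβ).const_mul C).mono'
    (Measurable.aestronglyMeasurable (by fun_prop))
    (ae_orthant _ fun s hs => abs_weighted_le j ht hφ hs)

theorem hasPd_weightedIntegral {n d : ℕ} (j : Fin n) {t : Fin n → ℝ} (ht : ∀ i, 0 < t i)
    (k : Fin d) {Φ Ψ : ℝ → (Fin d → ℝ) → ℝ} (mΦ : ∀ x, Measurable fun τ => Φ τ x)
    (mΨ : ∀ x, Measurable fun τ => Ψ τ x) {C C' β β' : ℝ} (hβ : -1 < β) (hβ' : -1 < β')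
    (hΦ : ∀ x τ, 0 < τ → |Φ τ x| ≤ C * τ ^ β) (hΨ : ∀ x τ, 0 < τ → |Ψ τ x| ≤ C' * τ ^ β')
    (hd : ∀ τ, 0 < τ → ∀ x, HasPd k (Φ τ) (Ψ τ x) x) (x : Fin d → ℝ) :
    HasPd k (fun x => weightedIntegral j t fun τ => Φ τ x)
      (weightedIntegral j t fun τ => Ψ τ x) x :=
  (hasPd_integral k (Φ := fun (s : Fin n → ℝ) x => (∏ i ∈ univ.erase j, s i) ^ 2 * Φ (∏ i, s i) x *
      ∏ i, Kbm (t i) (s i))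
    (Ψ := fun (s : Fin n → ℝ) x => (∏ i ∈ univ.erase j, s i) ^ 2 * Ψ (∏ i, s i) x *
      ∏ i, Kbm (t i) (s i))
    ((integrable_orthant_erase_sq j ht hβ').const_mul C')
    (fun x => integrable_weighted j ht (mΦ x) hβ (hΦ x))
    (fun x => (integrable_weighted j ht (mΨ x) hβ' (hΨ x)).aestronglyMeasurable)
    (ae_orthant _ fun _ hs x => abs_weighted_le j ht (hΨ x) hs)
    (ae_orthant _ fun s hs x => HasDerivAt.mul_const (HasDerivAt.const_mul _
      (hd (∏ i, s i) (Finset.prod_pos fun i _ => hs i) x)) _) x).2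

theorem weightedIntegral_sum {n : ℕ} {ι : Type*} (S : Finset ι) (j : Fin n) {t : Fin n → ℝ}
    (ht : ∀ i, 0 < t i) {Φ : ι → ℝ → ℝ} (mΦ : ∀ l, Measurable (Φ l)) {C β : ℝ} (hβ : -1 < β)
    (hΦ : ∀ l τ, 0 < τ → |Φ l τ| ≤ C * τ ^ β) :
    weightedIntegral j t (fun τ => ∑ l ∈ S, Φ l τ) = ∑ l ∈ S, weightedIntegral j t (Φ l) := by
  unfold weightedIntegral
  rw [← integral_finsetSum S fun l _ => integrable_weighted j ht (mΦ l) hβ (hΦ l)]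
  simp only [Finset.mul_sum, Finset.sum_mul]

theorem heat_sum {ι : Type*} (S : Finset ι) {d : ℕ} {τ : ℝ} (hτ : 0 < τ)
    {G : ι → (Fin d → ℝ) → ℝ} (hG : ∀ l, Measurable (G l)) {B : ℝ} (hB : ∀ l y, |G l y| ≤ B)
    (x : Fin d → ℝ) : heat τ (fun y => ∑ l ∈ S, G l y) x = ∑ l ∈ S, heat τ (G l) x := by
  unfold heat
  rw [← integral_finsetSum S fun l _ => integrable_mul_heatKernel hτ (hG l) (hB l) x]
  simp only [Finset.sum_mul]

section Regularity

variable {d : ℕ} {f : (Fin d → ℝ) → ℝ} {f₁ f₂ : Fin d → (Fin d → ℝ) → ℝ} {M M₁ M₂ : ℝ}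

theorem heatHess_eq_heat (hf : Measurable f) (hM : ∀ y, |f y| ≤ M)
    (hf₁ : ∀ l, Measurable (f₁ l)) (hM₁ : ∀ l y, |f₁ l y| ≤ M₁)
    (hf₂ : ∀ l, Measurable (f₂ l)) (hM₂ : ∀ l y, |f₂ l y| ≤ M₂)
    (h₁ : ∀ l x, HasPd l f (f₁ l x) x) (h₂ : ∀ l x, HasPd l (f₁ l) (f₂ l x) x)
    {τ : ℝ} (hτ : 0 < τ) (l : Fin d) (x : Fin d → ℝ) : heatHess l τ f x = heat τ (f₂ l) x := by
  have hi := integrable_mul_heatKernel hτ hf hM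
  have e : heat τ (f₁ l) = fun x => (heat τ (fun y => y l * f y) x - x l * heat τ f x) / τ := by
    funext x
    exact (heat_hasPd_of_hasPd l hτ hf hM (hf₁ l) (hM₁ l) (h₁ l) x).unique
      (heat_hasPd l hτ hi x).2
  have := heat_hasPd_of_hasPd l hτ (hf₁ l) (hM₁ l) (hf₂ l) (hM₂ l) (h₂ l) x
  rw [e] at this
  exact (heat_hasPd_hasPd l hτ hi x).2.unique this

theorem heat_hasDerivAt_time_laplacian (hf : Measurable f) (hM : ∀ y, |f y| ≤ M)
    (hf₁ : ∀ l, Measurable (f₁ l)) (hM₁ : ∀ l y, |f₁ l y| ≤ M₁)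
    (hf₂ : ∀ l, Measurable (f₂ l)) (hM₂ : ∀ l y, |f₂ l y| ≤ M₂)
    (h₁ : ∀ l x, HasPd l f (f₁ l x) x) (h₂ : ∀ l x, HasPd l (f₁ l) (f₂ l x) x)
    {τ : ℝ} (hτ : 0 < τ) (x : Fin d → ℝ) :
    HasDerivAt (fun τ => heat τ f x) (1 / 2 * heat τ (fun y => ∑ l, f₂ l y) x) τ := by
  rw [heat_sum univ hτ hf₂ hM₂, ← Finset.sum_congr rfl fun l _ =>
    heatHess_eq_heat hf hM hf₁ hM₁ hf₂ hM₂ h₁ h₂ hτ l x]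
  exact heat_hasDerivAt_time hτ (fun τ hτ => integrable_mul_heatKernel hτ hf hM) x

theorem lap_weightedIntegral_heat (hf : Measurable f) (hM : ∀ y, |f y| ≤ M)
    (hf₁ : ∀ l, Measurable (f₁ l)) (hM₁ : ∀ l y, |f₁ l y| ≤ M₁)
    (hf₂ : ∀ l, Measurable (f₂ l)) (hM₂ : ∀ l y, |f₂ l y| ≤ M₂)
    (h₁ : ∀ l x, HasPd l f (f₁ l x) x) (h₂ : ∀ l x, HasPd l (f₁ l) (f₂ l x) x)
    {n : ℕ} (j : Fin n) {t : Fin n → ℝ} (ht : ∀ i, 0 < t i) (c : ℝ) (x : Fin d → ℝ) :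
    lap (fun x => c * weightedIntegral j t fun τ => heat τ f x) x =
      c * weightedIntegral j t fun τ => heat τ (fun y => ∑ l, f₂ l y) x := by
  have bdd : ∀ {G : (Fin d → ℝ) → ℝ} {B : ℝ}, (∀ y, |G y| ≤ B) →
      ∀ x τ, 0 < τ → |heat τ G x| ≤ B * τ ^ (0 : ℝ) := fun hB x τ hτ => by
    simpa only [rpow_zero, mul_one] using abs_heat_le hτ hB x
  have e₁ : ∀ l, pd l (fun x => c * weightedIntegral j t fun τ => heat τ f x) =
      fun x => c * weightedIntegral j t fun τ => heat τ (f₁ l) x := fun l => funext fun x =>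
    ((hasPd_weightedIntegral j ht l (measurable_heat hf) (measurable_heat (hf₁ l))
      (by norm_num) (by norm_num) (bdd hM) (bdd (hM₁ l))
      (fun τ hτ => heat_hasPd_of_hasPd l hτ hf hM (hf₁ l) (hM₁ l) (h₁ l)) x).const_mul c).pd
  have e₂ : ∀ l x, pd l (fun x => c * weightedIntegral j t fun τ => heat τ (f₁ l) x) x =
      c * weightedIntegral j t fun τ => heat τ (f₂ l) x := fun l x =>
    ((hasPd_weightedIntegral j ht l (measurable_heat (hf₁ l)) (measurable_heat (hf₂ l))
      (by norm_num) (by norm_num) (bdd (hM₁ l)) (bdd (hM₂ l))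
      (fun τ hτ => heat_hasPd_of_hasPd l hτ (hf₁ l) (hM₁ l) (hf₂ l) (hM₂ l) (h₂ l)) x).const_mul c).pd
  simp only [lap, e₁, e₂]
  rw [← Finset.mul_sum, ← weightedIntegral_sum univ j ht (fun l => measurable_heat (hf₂ l) x)
    (by norm_num) fun l => bdd (hM₂ l) x]
  congr 1
  refine integral_congr_ae (ae_orthant _ fun s hs => ?_)
  simp only [heat_sum univ (Finset.prod_pos fun i _ => hs i) hf₂ hM₂]

end Regularity

theorem lap_weightedIntegral_heat_of_holder {d : ℕ} {g : (Fin d → ℝ) → ℝ} {B H α : ℝ}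
    (hg : Measurable g) (hB : ∀ y, |g y| ≤ B) (hH0 : 0 ≤ H) (hα1 : 0 < α) (hα2 : α ≤ 1)
    (hH : ∀ x y, |g x - g y| ≤ H * dist x y ^ α)
    {n : ℕ} (j : Fin n) {t : Fin n → ℝ} (ht : ∀ i, 0 < t i) (c : ℝ) (x : Fin d → ℝ) :
    lap (fun x => c * weightedIntegral j t fun τ => heat τ g x) x =
      c * weightedIntegral j t fun τ => ∑ k, heatHess k τ g x := by
  obtain ⟨C₁, -, hC₁⟩ := exists_abs_heat_deriv_le d
  obtain ⟨C₂, -, hC₂⟩ := exists_abs_heat_deriv2_le d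
  have b₀ : ∀ x τ, 0 < τ → |heat τ g x| ≤ B * τ ^ (0 : ℝ) := fun x τ hτ => by
    simpa only [rpow_zero, mul_one] using abs_heat_le hτ hB x
  have b₁ : ∀ (k : Fin d) (x) (τ : ℝ), 0 < τ →
      |(heat τ (fun y => y k * g y) x - x k * heat τ g x) / τ| ≤ B * C₁ * τ ^ (-1 / 2 : ℝ) :=
    fun k x τ hτ => hC₁ k τ hτ g hg B hB x
  have b₂ : ∀ (k : Fin d) (x) (τ : ℝ), 0 < τ → |heatHess k τ g x| ≤ H * C₂ * τ ^ (α / 2 - 1) :=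
    fun k x τ hτ => hC₂ k τ hτ g hg B hB H α hH0 hα1 hα2 hH x
  have m₁ : ∀ (k : Fin d) (x : Fin d → ℝ),
      Measurable fun τ => (heat τ (fun y => y k * g y) x - x k * heat τ g x) / τ := fun k x => by
    have h1 := measurable_heat hg x
    have h2 : Measurable fun τ => heat τ (fun y => y k * g y) x :=
      measurable_heat (by fun_prop) x
    fun_prop
  have e₁ : ∀ k, pd k (fun x => c * weightedIntegral j t fun τ => heat τ g x) =
      fun x => c * weightedIntegral j t fun τ =>
        (heat τ (fun y => y k * g y) x - x k * heat τ g x) / τ := fun k => funext fun x =>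
    ((hasPd_weightedIntegral j ht k (measurable_heat hg) (m₁ k) (by norm_num) (by norm_num) b₀ (b₁ k)
      (fun τ hτ x => (heat_hasPd k hτ (integrable_mul_heatKernel hτ hg hB) x).2) x).const_mul c).pd
  have e₂ : ∀ k x, pd k (fun x => c * weightedIntegral j t fun τ =>
        (heat τ (fun y => y k * g y) x - x k * heat τ g x) / τ) x =
      c * weightedIntegral j t fun τ => heatHess k τ g x := fun k x =>
    ((hasPd_weightedIntegral j ht k (m₁ k) (measurable_heatHess k hg) (by norm_num)
      (by linarith) (b₁ k) (b₂ k)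
      (fun τ hτ x => (heat_hasPd_hasPd k hτ (integrable_mul_heatKernel hτ hg hB) x).2)
      x).const_mul c).pd
  simp only [lap, e₁, e₂]
  rw [← Finset.mul_sum, ← weightedIntegral_sum univ j ht (fun k => measurable_heatHess k hg x)
    (by linarith) fun k => b₂ k x]

theorem prod_sqrt_mul {n : ℕ} {t : Fin n → ℝ} (ht : ∀ i, 0 ≤ t i) (r : Fin n → ℝ)
    (S : Finset (Fin n)) : ∏ i ∈ S, √(t i) * r i = √(∏ i ∈ S, t i) * ∏ i ∈ S, r i := by
  rw [Finset.prod_mul_distrib, Real.sqrt_prod _ fun i _ => ht i]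

/-- Brownian scaling of the weighted integral. -/
theorem weightedIntegral_scale {n : ℕ} (j : Fin n) {t : Fin n → ℝ} (ht : ∀ i, 0 < t i)
    (φ : ℝ → ℝ) : weightedIntegral j t φ = (∏ i ∈ univ.erase j, t i) *
      ∫ r, (∏ i ∈ univ.erase j, r i) ^ 2 * φ (√(∏ i, t i) * ∏ i, r i) *
        ∏ i, Kbm 1 (r i) ∂orthant n := by
  have := integral_orthant_scale ht fun s => (∏ i ∈ univ.erase j, s i) ^ 2 * φ (∏ i, s i)
  rw [weightedIntegral, this, ← integral_const_mul]
  refine integral_congr_ae (ae_of_all _ fun r => ?_)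
  simp only [prod_sqrt_mul fun i => (ht i).le, mul_pow,
    Real.sq_sqrt (Finset.prod_nonneg fun i _ => (ht i).le : 0 ≤ ∏ i ∈ univ.erase j, t i)]
  ring

theorem integral_prod_Kbm_one (n : ℕ) :
    ∫ r, ∏ i, Kbm 1 (r i) ∂orthant n = (1 / 2) ^ n := by
  rw [integral_orthant_prod fun _ => Kbm 1]
  simp [integral_Kbm one_pos]

theorem integral_erase_sq_mul_prod_Kbm_one {n : ℕ} (j : Fin n) :
    ∫ r, (∏ i ∈ univ.erase j, r i) ^ 2 * ∏ i, Kbm 1 (r i) ∂orthant n = (1 / 2) ^ n := by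
  have e : ∀ r : Fin n → ℝ, (∏ i ∈ univ.erase j, r i) ^ 2 * ∏ i, Kbm 1 (r i) =
      ∏ i, (fun i s => (if i = j then 1 else s ^ 2) * Kbm 1 s) i (r i) := fun r => by
    rw [Finset.prod_mul_distrib, ← Finset.mul_prod_erase _ (fun i => if i = j then 1 else r i ^ 2)
      (mem_univ j), if_pos rfl, one_mul, ← Finset.prod_pow]
    congr 1
    exact Finset.prod_congr rfl fun i hi => (if_neg (Finset.ne_of_mem_erase hi)).symm
  rw [integral_congr_ae (ae_of_all _ e),
    integral_orthant_prod fun i s => (if i = j then 1 else s ^ 2) * Kbm 1 s]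
  have : ∀ i, ∫ s in Set.Ioi 0, (if i = j then 1 else s ^ 2) * Kbm 1 s = 1 / 2 := fun i => by
    split_ifs
    · simpa only [one_mul] using integral_Kbm one_pos
    · exact integral_sq_mul_Kbm_one
  rw [Finset.prod_congr rfl fun i _ => this i]
  simp

theorem integrable_erase_sq_mul_prod_Kbm_one {n : ℕ} (j : Fin n) :
    Integrable (fun r : Fin n → ℝ => (∏ i ∈ univ.erase j, r i) ^ 2 * ∏ i, Kbm 1 (r i))
      (orthant n) := by
  simpa only [rpow_zero, mul_one] using
    integrable_orthant_erase_sq j (fun _ => one_pos) (β := 0) (by norm_num)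


theorem coeff_eq {n : ℕ} (j : Fin n) {t : Fin n → ℝ} (ht : ∀ i, 0 < t i) :
    2 ^ n * (1 / 4 * (Kbm (t j) 0 * ∏ i ∈ univ.erase j, √(t i / (2 * π)))) =
      √((∏ i ∈ univ.erase j, t i) / ((2 : ℝ) ^ ((4 : ℝ) - n) * π ^ n * t j)) := by
  have hP : 0 < ∏ i ∈ univ.erase j, t i := Finset.prod_pos fun i _ => ht i
  have htj := ht j
  have hK : Kbm (t j) 0 = √(2 * π * t j)⁻¹ := by
    rw [Kbm, sqrt_eq_rpow, ← rpow_neg_one, ← rpow_mul (by positivity)]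
    norm_num
  have h4 : (4 : ℝ) ^ n / 16 = (2 : ℝ) ^ n * (2 : ℝ) ^ n / 2 ^ 4 := by
    rw [← mul_pow]; norm_num
  rw [← Real.sqrt_prod _ fun i _ => by have := ht i; positivity, hK,
    ← Real.sqrt_mul (by positivity), show ∀ y : ℝ, 2 ^ n * (1 / 4 * y) = 2 ^ n / 4 * y by
      intro y; ring,
    ← Real.sqrt_sq (by positivity : (0 : ℝ) ≤ 2 ^ n / 4), ← Real.sqrt_mul (by positivity)]
  congr 1
  rw [Finset.prod_div_distrib, Finset.prod_const, Finset.card_erase_of_mem (mem_univ j),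
    Finset.card_univ, Fintype.card_fin, rpow_sub two_pos, rpow_natCast]
  obtain ⟨m, rfl⟩ : ∃ m, n = m + 1 := ⟨n - 1, by have := j.pos; omega⟩
  rw [Nat.add_sub_cancel]
  field_simp
  norm_num
  ring

/-- A function with bounded second partial derivatives is continuous together with its
first partial derivatives. -/
theorem continuous_of_pd_pd {d : ℕ} {f : (Fin d → ℝ) → ℝ} {M M₂ : ℝ} (hb : ∀ y, |f y| ≤ M)
    (h₁ : ∀ l x, HasPd l f (pd l f x) x) (h₂ : ∀ k l x, HasPd k (pd l f) (pd k (pd l f) x) x)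
    (hb₂ : ∀ k l x, |pd k (pd l f) x| ≤ M₂) :
    Continuous f ∧ (∀ l, Continuous (pd l f)) ∧ ∀ l x, |pd l f x| ≤ 2 * M + M₂ := by
  have hb₁ : ∀ l x, |pd l f x| ≤ 2 * M + M₂ := fun l x =>
    abs_pd_le_of_bounded (h₁ l) (h₂ l l) hb (hb₂ l l) x
  exact ⟨continuous_of_hasPd_bounded h₁ hb₁,
    fun l => continuous_of_hasPd_bounded (fun k => h₂ k l) (fun k => hb₂ k l), hb₁⟩

theorem tendsto_sqrt_prod_nhdsWithin {n : ℕ} {t₀ : Fin n → ℝ} (h : ∃ i, t₀ i = 0) :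
    Tendsto (fun t : Fin n → ℝ => √(∏ i, t i)) (nhdsWithin t₀ {t | ∀ i, 0 < t i})
      (nhdsWithin 0 (Set.Ioi 0)) := by
  obtain ⟨i, hi⟩ := h
  have hc : Continuous fun t : Fin n → ℝ => √(∏ i, t i) := by fun_prop
  have h0 := hc.tendsto t₀
  rw [Finset.prod_eq_zero (mem_univ i) hi, sqrt_zero] at h0
  refine tendsto_nhdsWithin_iff.2 ⟨h0.mono_left nhdsWithin_le_nhds, ?_⟩
  filter_upwards [self_mem_nhdsWithin] with t ht
  exact sqrt_pos.2 (Finset.prod_pos fun i _ => ht i)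

theorem prod_erase_update {n : ℕ} (j : Fin n) (t : Fin n → ℝ) (h : ℝ) :
    ∏ i ∈ univ.erase j, Function.update t j h i = ∏ i ∈ univ.erase j, t i :=
  Finset.prod_congr rfl fun _ hi => Function.update_of_ne (Finset.ne_of_mem_erase hi) _ _

theorem prod_update {n : ℕ} (j : Fin n) (t : Fin n → ℝ) (h : ℝ) :
    ∏ i, Function.update t j h i = h * ∏ i ∈ univ.erase j, t i := by
  rw [← Finset.mul_prod_erase _ _ (mem_univ j), prod_erase_update, Function.update_self]

theorem update_pos {n : ℕ} {j : Fin n} {t : Fin n → ℝ} (ht : ∀ i, i ≠ j → 0 < t i) {h : ℝ}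
    (hh : 0 < h) (i : Fin n) : 0 < Function.update t j h i := by
  rcases eq_or_ne i j with rfl | hi
  · rwa [Function.update_self]
  · rw [Function.update_of_ne hi]
    exact ht i hi

theorem integral_orthant_scale_prod {n : ℕ} {t : Fin n → ℝ} (ht : ∀ i, 0 < t i) (φ : ℝ → ℝ) :
    ∫ s, φ (∏ i, s i) * ∏ i, Kbm (t i) (s i) ∂orthant n =
      ∫ r, φ (√(∏ i, t i) * ∏ i, r i) * ∏ i, Kbm 1 (r i) ∂orthant n := by
  rw [integral_orthant_scale ht fun s => φ (∏ i, s i)]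
  simp only [prod_sqrt_mul fun i => (ht i).le]

/-- Time derivative of the averaged function. -/
theorem hasPd_integral_orthant {n : ℕ} (j : Fin n) {t : Fin n → ℝ} (ht : ∀ i, 0 < t i)
    {φ ψ χ : ℝ → ℝ} (hφ : Measurable φ) (hψ : Measurable ψ) (hχ : Measurable χ) {M B C β g : ℝ}
    (hM : ∀ τ, 0 < τ → |φ τ| ≤ M) (hB : ∀ τ, 0 < τ → |ψ τ| ≤ B)
    (hC : ∀ τ, 0 < τ → |χ τ| ≤ C * τ ^ β) (hβ : -1 < β)
    (hd₁ : ∀ τ, 0 < τ → HasDerivAt φ (1 / 2 * ψ τ) τ)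
    (hd₂ : ∀ τ, 0 < τ → HasDerivAt ψ (1 / 2 * χ τ) τ)
    (h0 : Tendsto ψ (nhdsWithin 0 (Set.Ioi 0)) (nhds g)) :
    HasPd j (fun t => ∫ s, φ (∏ i, s i) * ∏ i, Kbm (t i) (s i) ∂orthant n)
      (1 / 4 * (g * Kbm (t j) 0 * (∏ i ∈ univ.erase j, √(t i / (2 * π))) +
        1 / 2 * weightedIntegral j t χ)) t := by
  obtain ⟨m, rfl⟩ : ∃ m, n = m + 1 := ⟨n - 1, by have := j.pos; omega⟩
  have ha : 0 < √(∏ i ∈ univ.erase j, t i) := sqrt_pos.2 (Finset.prod_pos fun i _ => ht i)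
  have key := hasDerivAt_integral_orthant (n := m + 1) hφ hψ hM hB hd₁ ha (ht j)
  have e : √(t j) * √(∏ i ∈ univ.erase j, t i) = √(∏ i, t i) := by
    rw [← sqrt_mul (ht j).le, Finset.mul_prod_erase _ _ (mem_univ j)]
  rw [e, ← integral_orthant_scale_prod ht fun ρ => ψ ρ * (ρ / t j),
    integral_orthant_by_parts j ht hψ hχ hB hC hβ hd₂ h0] at key
  refine key.congr_of_eventuallyEq ?_
  filter_upwards [Ioi_mem_nhds (ht j)] with h hh
  rw [integral_orthant_scale_prod (update_pos (fun i _ => ht i) hh), prod_update,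
    sqrt_mul (le_of_lt hh)]

/-- the Brownian-time Brownian sheet system of fourth order
interacting linear PDEs: with
`u(t,x) = 2ⁿ∫_{(0,∞)ⁿ} E(s,x)∏K^{BM}(t_i;0,s_i)ds` and
`𝒰^{(j)}(t,x) = 2ⁿ∫_{(0,∞)ⁿ} (∏_{i≠j}s_i)² E(s,x)∏K^{BM}(t_i;0,s_i)ds`, one has
(a) `∂u/∂t_j = √((∏_{i≠j}t_i)/(2^{4-n}πⁿt_j)) Δ_x f + (1/8)Δ_x²𝒰^{(j)}`,
(b) `u = f` on the boundary of `ℝ₊ⁿ`,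
(c) `𝒰^{(j)} = 0` when some `t_i = 0` with `i ≠ j`, and
(d) `𝒰^{(j)} = (∏_{i≠j}t_i) f` as `t_j → 0⁺`. -/
theorem btbs_fourth_order_interacting_system
    (n d : ℕ) (hn : 1 ≤ n) (hd : 1 ≤ d)
    (f : (Fin d → ℝ) → ℝ) (hmeas : Measurable f) (M : ℝ) (hb : ∀ y, |f y| ≤ M)
    (α : ℝ) (hα1 : 0 < α) (hα2 : α ≤ 1)
    (hf1 : ∀ (l : Fin d) (x : Fin d → ℝ),
      DifferentiableAt ℝ (fun h : ℝ => f (Function.update x l h)) (x l))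
    (hf2 : ∀ (k l : Fin d) (x : Fin d → ℝ),
      DifferentiableAt ℝ (fun h : ℝ => pd l f (Function.update x k h)) (x k))
    (M₂ : ℝ) (hb2 : ∀ (k l : Fin d) (x : Fin d → ℝ), |pd k (pd l f) x| ≤ M₂)
    (H : ℝ) (hH : ∀ (k l : Fin d) (x y : Fin d → ℝ),
      |pd k (pd l f) x - pd k (pd l f) y| ≤ H * dist x y ^ α)
    (E : (Fin n → ℝ) → (Fin d → ℝ) → ℝ)
    (hE : ∀ s x, E s x = ∫ y : Fin d → ℝ, f y * Kbs n d s x y)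
    (u : (Fin n → ℝ) → (Fin d → ℝ) → ℝ)
    (hu : ∀ t x, u t x
      = 2 ^ n * ∫ s in {s : Fin n → ℝ | ∀ i, 0 < s i},
          E s x * ∏ i, Kbm (t i) (s i))
    (U : Fin n → (Fin n → ℝ) → (Fin d → ℝ) → ℝ)
    (hU : ∀ j t x, U j t x
      = 2 ^ n * ∫ s in {s : Fin n → ℝ | ∀ i, 0 < s i},
          (∏ i ∈ Finset.univ.erase j, s i) ^ 2 * E s x * ∏ i, Kbm (t i) (s i)) :
    -- (a) the interacting fourth order PDEs
    (∀ (j : Fin n) (t : Fin n → ℝ), (∀ i, 0 < t i) → ∀ x : Fin d → ℝ,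
      pd j (fun t' => u t' x) t
        = Real.sqrt ((∏ i ∈ Finset.univ.erase j, t i) /
            ((2 : ℝ) ^ ((4 : ℝ) - n) * π ^ n * t j)) * lap f x
          + (1 / 8) * lap (lap (U j t)) x) ∧
    -- (b) boundary value of `u`
    (∀ t₀ : Fin n → ℝ, (∀ i, 0 ≤ t₀ i) → (∃ i, t₀ i = 0) → ∀ x : Fin d → ℝ,
      Filter.Tendsto (fun t => u t x)
        (nhdsWithin t₀ {t : Fin n → ℝ | ∀ i, 0 < t i}) (nhds (f x))) ∧
    -- (c) boundary value of `𝒰^{(j)}` off the `j`-th coordinate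
    (∀ (j : Fin n) (t₀ : Fin n → ℝ), (∀ i, 0 ≤ t₀ i) →
      (∃ i, i ≠ j ∧ t₀ i = 0) → ∀ x : Fin d → ℝ,
      Filter.Tendsto (fun t => U j t x)
        (nhdsWithin t₀ {t : Fin n → ℝ | ∀ i, 0 < t i}) (nhds 0)) ∧
    -- (d) boundary value of `𝒰^{(j)}` as `t_j → 0⁺`
    (∀ (j : Fin n) (t : Fin n → ℝ), (∀ i, i ≠ j → 0 < t i) → ∀ x : Fin d → ℝ,
      Filter.Tendsto (fun h : ℝ => U j (Function.update t j h) x)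
        (nhdsWithin 0 (Set.Ioi 0))
        (nhds ((∏ i ∈ Finset.univ.erase j, t i) * f x))) := by
  have h₁ : ∀ l x, HasPd l f (pd l f x) x := fun l x => (hf1 l x).hasDerivAt
  have h₂ : ∀ k l x, HasPd k (pd l f) (pd k (pd l f) x) x := fun k l x => (hf2 k l x).hasDerivAt
  obtain ⟨cf, cf₁, hb₁⟩ := continuous_of_pd_pd hb h₁ h₂ hb2
  have cf₂ : ∀ l, Continuous (pd l (pd l f)) := fun l => continuous_of_abs_sub_le_rpow hα1 (hH l l)
  have mf₁ := fun l => (cf₁ l).measurable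
  have mf₂ := fun l => (cf₂ l).measurable
  have cg : Continuous (lap f) := continuous_finsetSum _ fun l _ => cf₂ l
  have hg : ∀ x, |lap f x| ≤ d * M₂ := fun x => by
    refine (Finset.abs_sum_le_sum_abs _ _).trans ((Finset.sum_le_sum fun l _ => hb2 l l x).trans ?_)
    simp
  have hgH : ∀ x y, |lap f x - lap f y| ≤ d * |H| * dist x y ^ α := fun x y => by
    simp only [lap]
    rw [← Finset.sum_sub_distrib]
    refine (Finset.abs_sum_le_sum_abs _ _).trans ((Finset.sum_le_sum fun l _ => (hH l l x y).trans
      (mul_le_mul_of_nonneg_right (le_abs_self H) (rpow_nonneg dist_nonneg α))).trans ?_)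
    simp [mul_assoc]
  have hu' : ∀ t x, u t x =
      2 ^ n * ∫ s, heat (∏ i, s i) f x * ∏ i, Kbm (t i) (s i) ∂orthant n := fun t x => by
    simp only [hu, hE]
    rfl
  have hU' : ∀ j t, U j t = fun x => 2 ^ n * weightedIntegral j t fun τ => heat τ f x :=
    fun j t => funext fun x => by
      simp only [hU, hE]
      rfl
  refine ⟨fun j t ht x => ?_, fun t₀ _ h0 x => ?_, fun j t₀ ht₀ h0 x => ?_, fun j t ht x => ?_⟩
  · obtain ⟨C, hC0, hC⟩ := exists_abs_heat_deriv2_le d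
    have hlap : lap (U j t) = fun x => 2 ^ n * weightedIntegral j t fun τ => heat τ (lap f) x := by
      rw [hU']
      exact funext fun x => lap_weightedIntegral_heat hmeas hb mf₁ hb₁ mf₂ (fun l => hb2 l l) h₁
        (fun l => h₂ l l) j ht _ x
    have key := (hasPd_integral_orthant j ht (measurable_heat hmeas x)
      (measurable_heat cg.measurable x)
      (Finset.measurable_fun_sum univ fun k _ => measurable_heatHess k cg.measurable x)
      (fun τ hτ => abs_heat_le hτ hb x) (fun τ hτ => abs_heat_le hτ hg x)
      (C := d * (d * |H| * C)) (β := α / 2 - 1)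
      (fun τ hτ => ?_) (by linarith)
      (fun τ hτ => heat_hasDerivAt_time_laplacian hmeas hb mf₁ hb₁ mf₂ (fun l => hb2 l l) h₁
        (fun l => h₂ l l) hτ x)
      (fun τ hτ => heat_hasDerivAt_time hτ
        (fun τ hτ => integrable_mul_heatKernel hτ cg.measurable hg) x)
      (tendsto_heat cg hg x)).const_mul (2 ^ n)
    · rw [hlap, lap_weightedIntegral_heat_of_holder cg.measurable hg (by positivity) hα1 hα2 hgH j ht,
        ← coeff_eq j ht]
      simp only [hu']
      rw [key.pd]
      ring
    · refine (Finset.abs_sum_le_sum_abs _ _).trans ((Finset.sum_le_sum fun k _ => hC k τ hτ _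
        cg.measurable _ hg (d * |H|) α (by positivity) hα1 hα2 hgH x).trans ?_)
      simp [mul_assoc]
  · have hw : Integrable (fun r : Fin n → ℝ => 1 * ∏ i, Kbm 1 (r i)) (orthant n) := by
      have := integrable_orthant_prod (n := n) (fun _ => one_pos) (e := fun _ => 0)
        fun _ => by norm_num
      simpa only [rpow_zero, Finset.prod_const_one] using this
    have key := (tendsto_integral_orthant hw (measurable_heat hmeas x)
      (fun τ hτ => abs_heat_le hτ hb x) (tendsto_heat cf hb x)
      (tendsto_sqrt_prod_nhdsWithin h0)).const_mul (2 ^ n)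
    simp only [one_mul, integral_prod_Kbm_one] at key
    rw [mul_left_comm, ← mul_pow, mul_one_div_cancel two_ne_zero, one_pow, mul_one] at key
    refine key.congr' ?_
    filter_upwards [self_mem_nhdsWithin] with t ht
    rw [hu', integral_orthant_scale_prod ht fun τ => heat τ f x]
  · obtain ⟨i, hij, hi⟩ := h0
    have key := (tendsto_integral_orthant (w := fun r => (∏ i ∈ univ.erase j, r i) ^ 2)
      (integrable_erase_sq_mul_prod_Kbm_one j) (measurable_heat hmeas x)
      (fun τ hτ => abs_heat_le hτ hb x) (tendsto_heat cf hb x)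
      (tendsto_sqrt_prod_nhdsWithin ⟨i, hi⟩)).const_mul (2 ^ n)
    have hc : Continuous fun t : Fin n → ℝ => ∏ i ∈ univ.erase j, t i := by fun_prop
    have hP := hc.tendsto t₀
    rw [Finset.prod_eq_zero (Finset.mem_erase.2 ⟨hij, mem_univ i⟩) hi] at hP
    have hlim := (hP.mono_left nhdsWithin_le_nhds).mul key
    rw [zero_mul] at hlim
    refine hlim.congr' ?_
    filter_upwards [self_mem_nhdsWithin] with t ht
    simp only [hU', weightedIntegral_scale j ht]
    ring
  · have hP : 0 < ∏ i ∈ univ.erase j, t i :=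
      Finset.prod_pos fun i hi => ht i (Finset.ne_of_mem_erase hi)
    have hc : Tendsto (fun h => √(h * ∏ i ∈ univ.erase j, t i)) (nhdsWithin 0 (Set.Ioi 0))
        (nhdsWithin 0 (Set.Ioi 0)) := by
      have hc : Continuous fun h => √(h * ∏ i ∈ univ.erase j, t i) := by fun_prop
      have h0 := hc.tendsto 0
      rw [zero_mul, sqrt_zero] at h0
      refine tendsto_nhdsWithin_iff.2 ⟨h0.mono_left nhdsWithin_le_nhds, ?_⟩
      filter_upwards [self_mem_nhdsWithin] with h hh using sqrt_pos.2 (mul_pos hh hP)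
    have key := (tendsto_integral_orthant (w := fun r => (∏ i ∈ univ.erase j, r i) ^ 2)
      (integrable_erase_sq_mul_prod_Kbm_one j) (measurable_heat hmeas x)
      (fun τ hτ => abs_heat_le hτ hb x) (tendsto_heat cf hb x) hc).const_mul
        (2 ^ n * ∏ i ∈ univ.erase j, t i)
    rw [integral_erase_sq_mul_prod_Kbm_one, show ∀ a b : ℝ, 2 ^ n * a * (b * (1 / 2) ^ n) =
      (2 * (1 / 2)) ^ n * (a * b) by intro a b; rw [mul_pow]; ring,
      mul_one_div_cancel two_ne_zero, one_pow, one_mul] at key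
    refine key.congr' ?_
    filter_upwards [self_mem_nhdsWithin] with h hh
    simp only [hU', weightedIntegral_scale j (update_pos ht hh), prod_erase_update, prod_update]
    ring
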